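/- There exist universal constants C, c > 0 such that the following is true (main theorem, Case ia). Let (n, k, ε, r, p) ∈ ℕ × ℕ × (0,1/2) × [0,1/2] × [3/2,∞) with n ≥ 3, and let G be an n×k random matrix with i.i.d. standard normal entries. Define E = c^p·n·(ln n)²·[p + (1−2r)·ln n]^p·ε²/(p + ln n)^{2+p} and F = c·p·n^{2(1−r)/p}·(ln n)^{1+2/p}·ε^{2/p}/[(1 + n^{(2−2r−p)/p})·(p + ln n)^{1+2/p}]·((1 + |2−2r−p|·ln n)/ln n)^{max{(2−p)/p, 0}}. If k ≤ min{E, F}, then with probability at least 1 − C·exp(−min{E, F}), for all x ∈ ℝ^k: (1−ε)·M_{r,p}·|x| ≤ |Gx|_{r,p} ≤ (1+ε)·M_{r,p}·|x|, where M_{r,p} = 𝕄 |Ge₁|_{r,p}. -/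

import Mathlib

open MeasureTheory ProbabilityTheory

/-- `decRe x` is the non-increasing rearrangement of `(|x_1|, …, |x_n|)`
(indexed from `0`, so `decRe x i = x_[i+1]` in the paper's notation). -/
noncomputable def decRe {n : ℕ} (x : Fin n → ℝ) : Fin n → ℝ :=
  fun i => |x (Tuple.sort (fun j => |x j|) i.rev)|

/-- The finite-dimensional Lorentz norm `|x|_{r,p} = (∑_{i=1}^n i^{-r} x_[i]^p)^{1/p}`. -/
noncomputable def lorNorm {n : ℕ} (r p : ℝ) (x : Fin n → ℝ) : ℝ :=
  (∑ i : Fin n, ((i : ℝ) + 1) ^ (-r) * decRe x i ^ p) ^ (1 / p)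

/-- The standard Gaussian measure `N(0, I_n)` on `ℝ^n`. -/
noncomputable def stdGaussian (n : ℕ) : Measure (Fin n → ℝ) :=
  Measure.pi fun _ => gaussianReal 0 1

/-- The law of an `n × k` random matrix with i.i.d. standard normal entries. -/
noncomputable def gaussMatrix (n k : ℕ) : Measure (Fin n → Fin k → ℝ) :=
  Measure.pi fun _ => Measure.pi fun _ => gaussianReal 0 1

/-- `mulVec g x = Gx`, the matrix-vector product. -/
noncomputable def mulVec {n k : ℕ} (g : Fin n → Fin k → ℝ) (x : Fin k → ℝ) : Fin n → ℝ :=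
  fun i => ∑ j : Fin k, g i j * x j

/-- The Euclidean norm on `Fin k → ℝ`. -/
noncomputable def eucNorm {k : ℕ} (x : Fin k → ℝ) : ℝ :=
  Real.sqrt (∑ j : Fin k, x j ^ 2)

/-- `m` is a median of `f` under `μ`. -/
def IsMedian {α : Type*} [MeasurableSpace α] (μ : Measure α) (f : α → ℝ) (m : ℝ) : Prop :=
  (1 : ENNReal) / 2 ≤ μ {x | m ≤ f x} ∧ (1 : ENNReal) / 2 ≤ μ {x | f x ≤ m}

/-- The quantity `E` of Case ia. -/
noncomputable def Eia (n : ℕ) (ε r p c : ℝ) : ℝ :=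
  c ^ p * n * Real.log n ^ 2 * (p + (1 - 2 * r) * Real.log n) ^ p * ε ^ 2 /
    (p + Real.log n) ^ (2 + p)

/-- The quantity `F` of Case ia. -/
noncomputable def Fia (n : ℕ) (ε r p c : ℝ) : ℝ :=
  c * p * (n : ℝ) ^ (2 * (1 - r) / p) * Real.log n ^ (1 + 2 / p) * ε ^ (2 / p) /
      ((1 + (n : ℝ) ^ ((2 - 2 * r - p) / p)) * (p + Real.log n) ^ (1 + 2 / p)) *
    ((1 + |2 - 2 * r - p| * Real.log n) / Real.log n) ^ max ((2 - p) / p) 0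

/-- The weighted power sum whose `p`-th root is the Lorentz norm. -/
noncomputable def lorSum {n : ℕ} (r p : ℝ) (x : Fin n → ℝ) : ℝ :=
  ∑ i : Fin n, ((i : ℝ) + 1) ^ (-r) * decRe x i ^ p

lemma lorNorm_eq {n : ℕ} (r p : ℝ) (x : Fin n → ℝ) :
    lorNorm r p x = lorSum r p x ^ (1 / p) := rfl

lemma decRe_eq_perm {n : ℕ} (x : Fin n → ℝ) :
    ∃ σ : Equiv.Perm (Fin n), ∀ i, decRe x i = |x (σ i)| :=
  ⟨Fin.revPerm.trans (Tuple.sort fun j => |x j|), fun _ => rfl⟩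

lemma decRe_nonneg {n : ℕ} (x : Fin n → ℝ) (i : Fin n) : 0 ≤ decRe x i := abs_nonneg _

lemma decRe_antitone {n : ℕ} (x : Fin n → ℝ) : Antitone (decRe x) := fun _ _ hij =>
  Tuple.monotone_sort (fun j => |x j|) (Fin.rev_le_rev.2 hij)

lemma weight_pos {n : ℕ} (r : ℝ) (i : Fin n) : 0 < ((i : ℝ) + 1) ^ (-r) := by positivity

lemma lorSum_nonneg {n : ℕ} (r p : ℝ) (x : Fin n → ℝ) : 0 ≤ lorSum r p x :=
  Finset.sum_nonneg fun i _ =>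
    mul_nonneg (weight_pos r i).le (Real.rpow_nonneg (decRe_nonneg x i) p)

lemma lorNorm_nonneg {n : ℕ} (r p : ℝ) (x : Fin n → ℝ) : 0 ≤ lorNorm r p x :=
  Real.rpow_nonneg (lorSum_nonneg r p x) _

lemma sum_perm_le_lorSum {n : ℕ} {r p : ℝ} (hr : 0 ≤ r) (hp : 0 ≤ p) (x : Fin n → ℝ)
    (τ : Equiv.Perm (Fin n)) :
    ∑ i : Fin n, ((i : ℝ) + 1) ^ (-r) * |x (τ i)| ^ p ≤ lorSum r p x := by
  obtain ⟨σ, hσ⟩ := decRe_eq_perm x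
  have hmono : Monovary (fun i : Fin n => ((i : ℝ) + 1) ^ (-r)) (fun i => decRe x i ^ p) := by
    intro i j hij
    have hlt : decRe x i < decRe x j := by
      by_contra hcon
      exact absurd hij (not_lt.2 (Real.rpow_le_rpow (decRe_nonneg x j) (not_lt.1 hcon) hp))
    have hji : j ≤ i := by
      by_contra hcon
      exact absurd hlt (not_lt.2 (decRe_antitone x (not_le.1 hcon).le))
    have : (j : ℝ) ≤ i := by exact_mod_cast hji
    exact Real.rpow_le_rpow_of_nonpos (by positivity) (by linarith) (by linarith)
  have := hmono.sum_mul_comp_perm_le_sum_mul (σ := τ.trans σ.symm)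
  simpa [lorSum, hσ] using this

lemma exists_perm_lorSum_eq {n : ℕ} (x : Fin n → ℝ) :
    ∃ σ : Equiv.Perm (Fin n), ∀ r p : ℝ,
      lorSum r p x = ∑ i : Fin n, ((i : ℝ) + 1) ^ (-r) * |x (σ i)| ^ p := by
  obtain ⟨σ, hσ⟩ := decRe_eq_perm x
  exact ⟨σ, fun r p => by simp [lorSum, hσ]⟩

lemma lorSum_smul {n : ℕ} {r p : ℝ} (t : ℝ) (x : Fin n → ℝ) (hr : 0 ≤ r) (hp : 0 ≤ p) :
    lorSum r p (fun i => t * x i) = |t| ^ p * lorSum r p x := by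
  have key : ∀ σ : Equiv.Perm (Fin n),
      ∑ i : Fin n, ((i : ℝ) + 1) ^ (-r) * |t * x (σ i)| ^ p =
        |t| ^ p * ∑ i : Fin n, ((i : ℝ) + 1) ^ (-r) * |x (σ i)| ^ p := by
    intro σ
    rw [Finset.mul_sum]
    refine Finset.sum_congr rfl fun i _ => ?_
    rw [abs_mul, Real.mul_rpow (abs_nonneg _) (abs_nonneg _)]
    ring
  apply le_antisymm
  · obtain ⟨σ, hσ⟩ := exists_perm_lorSum_eq fun i => t * x i
    rw [hσ, key]
    exact mul_le_mul_of_nonneg_left (sum_perm_le_lorSum hr hp x σ) (by positivity)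
  · obtain ⟨σ, hσ⟩ := exists_perm_lorSum_eq x
    rw [hσ, ← key]
    exact sum_perm_le_lorSum hr hp (fun i => t * x i) σ

lemma lorNorm_smul {n : ℕ} {r p : ℝ} (t : ℝ) (x : Fin n → ℝ) (hr : 0 ≤ r) (hp : 0 < p) :
    lorNorm r p (fun i => t * x i) = |t| * lorNorm r p x := by
  rw [lorNorm_eq, lorSum_smul t x hr hp.le, lorNorm_eq,
    Real.mul_rpow (by positivity) (lorSum_nonneg _ _ _), ← Real.rpow_mul (abs_nonneg t),
    mul_one_div_cancel hp.ne', Real.rpow_one]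

lemma lorNorm_rpow {n : ℕ} {r p : ℝ} (x : Fin n → ℝ) (hp : 0 < p) :
    lorNorm r p x ^ p = lorSum r p x := by
  rw [lorNorm_eq, ← Real.rpow_mul (lorSum_nonneg _ _ _), one_div_mul_cancel hp.ne', Real.rpow_one]

lemma eucNorm_nonneg {k : ℕ} (x : Fin k → ℝ) : 0 ≤ eucNorm x := Real.sqrt_nonneg _

lemma eucNorm_eq_norm {k : ℕ} (x : Fin k → ℝ) : eucNorm x = ‖WithLp.toLp 2 x‖ := by
  simp [eucNorm, EuclideanSpace.norm_eq]

lemma sum_sq_perm {n : ℕ} (x : Fin n → ℝ) (σ : Equiv.Perm (Fin n)) :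
    Real.sqrt (∑ i, |x (σ i)| ^ 2) = eucNorm x := by
  simp only [sq_abs, eucNorm]
  rw [Equiv.sum_comp σ fun i => x i ^ 2]

lemma lorNorm_le_add_sub {n : ℕ} {r q : ℝ} (hr : 0 ≤ r) (hq : 1 ≤ q) (x y : Fin n → ℝ) :
    lorNorm r q x ≤ lorNorm r q y + lorNorm r q (x - y) := by
  have hq0 : 0 < q := by linarith
  obtain ⟨σ, hσ⟩ := exists_perm_lorSum_eq x
  have hw : ∀ (z : Fin n → ℝ), ∑ i : Fin n, ((i : ℝ) + 1) ^ (-r) * |z (σ i)| ^ q =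
      ∑ i : Fin n, |((i : ℝ) + 1) ^ (-r / q) * z (σ i)| ^ q := by
    intro z
    refine Finset.sum_congr rfl fun i _ => ?_
    rw [abs_mul, Real.mul_rpow (abs_nonneg _) (abs_nonneg _),
      abs_of_pos (by positivity : (0 : ℝ) < ((i : ℝ) + 1) ^ (-r / q)),
      ← Real.rpow_mul (by positivity), div_mul_cancel₀ _ hq0.ne']
  have hmink := Real.Lp_add_le Finset.univ
    (fun i : Fin n => ((i : ℝ) + 1) ^ (-r / q) * y (σ i))
    (fun i : Fin n => ((i : ℝ) + 1) ^ (-r / q) * (x - y) (σ i)) hq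
  have hsum : ∀ i : Fin n, ((i : ℝ) + 1) ^ (-r / q) * y (σ i) +
      ((i : ℝ) + 1) ^ (-r / q) * (x - y) (σ i) = ((i : ℝ) + 1) ^ (-r / q) * x (σ i) := by
    intro i; simp only [Pi.sub_apply]; ring
  simp only [hsum] at hmink
  rw [← hw, ← hw, ← hw, ← hσ] at hmink
  refine hmink.trans (add_le_add ?_ ?_) <;>
  · refine Real.rpow_le_rpow (Finset.sum_nonneg fun i _ => by positivity)
      (sum_perm_le_lorSum hr hq0.le _ σ) (by positivity)

lemma rpow_sub_rpow_le {a b p : ℝ} (ha : 0 ≤ a) (hb : 0 ≤ b) (hp : 1 ≤ p) :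
    a ^ p - b ^ p ≤ p * a ^ (p - 1) * |a - b| := by
  rcases ha.eq_or_lt with rfl | ha'
  · rw [Real.zero_rpow (by linarith)]
    have := Real.rpow_nonneg hb p
    have : 0 ≤ p * (0 : ℝ) ^ (p - 1) * |0 - b| := by positivity
    linarith
  · have h1 := one_add_mul_self_le_rpow_one_add (s := b / a - 1) (by
      have : 0 ≤ b / a := by positivity
      linarith) hp
    have h2 : 1 + (b / a - 1) = b / a := by ring
    rw [h2, Real.div_rpow hb ha, le_div_iff₀ (by positivity)] at h1
    have h3 : a ^ p = a ^ (p - 1) * a := by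
      rw [← Real.rpow_add_one ha'.ne']; ring_nf
    have h4 : (1 + p * (b / a - 1)) * a ^ p = a ^ p - p * a ^ (p - 1) * (a - b) := by
      rw [h3]; field_simp; ring
    have h5 : p * a ^ (p - 1) * (a - b) ≤ p * a ^ (p - 1) * |a - b| :=
      mul_le_mul_of_nonneg_left (le_abs_self _) (by positivity)
    linarith

lemma lorSum_sub_le {n : ℕ} {r p : ℝ} (hr : 0 ≤ r) (hp : 1 ≤ p) (x y : Fin n → ℝ) :
    lorSum r p x - lorSum r p y ≤
      p * Real.sqrt (lorSum (2 * r) (2 * (p - 1)) x) * eucNorm (x - y) := by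
  obtain ⟨σ, hσ⟩ := exists_perm_lorSum_eq x
  have h1 : lorSum r p x - lorSum r p y ≤
      ∑ i : Fin n, ((i : ℝ) + 1) ^ (-r) * (|x (σ i)| ^ p - |y (σ i)| ^ p) := by
    simp only [mul_sub, Finset.sum_sub_distrib]
    rw [hσ]
    linarith [sum_perm_le_lorSum hr (by linarith : 0 ≤ p) y σ]
  have h2 : ∑ i : Fin n, ((i : ℝ) + 1) ^ (-r) * (|x (σ i)| ^ p - |y (σ i)| ^ p) ≤
      ∑ i : Fin n, p * ((((i : ℝ) + 1) ^ (-r) * |x (σ i)| ^ (p - 1)) * |(x - y) (σ i)|) := by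
    refine Finset.sum_le_sum fun i _ => ?_
    have := rpow_sub_rpow_le (abs_nonneg (x (σ i))) (abs_nonneg (y (σ i))) hp
    have h3 := abs_abs_sub_abs_le (x (σ i)) (y (σ i))
    calc ((i : ℝ) + 1) ^ (-r) * (|x (σ i)| ^ p - |y (σ i)| ^ p)
        ≤ ((i : ℝ) + 1) ^ (-r) * (p * |x (σ i)| ^ (p - 1) * |x (σ i) - y (σ i)|) := by
          gcongr
          exact this.trans (by gcongr)
      _ = _ := by simp only [Pi.sub_apply]; ring
  have h3 := Real.sum_mul_le_sqrt_mul_sqrt Finset.univ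
    (fun i : Fin n => ((i : ℝ) + 1) ^ (-r) * |x (σ i)| ^ (p - 1))
    (fun i => |(x - y) (σ i)|)
  have h4 : ∑ i : Fin n, (((i : ℝ) + 1) ^ (-r) * |x (σ i)| ^ (p - 1)) ^ 2 =
      lorSum (2 * r) (2 * (p - 1)) x := by
    rw [hσ]
    refine Finset.sum_congr rfl fun i _ => ?_
    rw [mul_pow, ← Real.rpow_mul_natCast (by positivity), ← Real.rpow_mul_natCast (abs_nonneg _)]
    push_cast
    ring_nf
  rw [h4, sum_sq_perm] at h3
  rw [← Finset.mul_sum] at h2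
  calc _ ≤ _ := h1.trans h2
    _ ≤ p * (Real.sqrt (lorSum (2 * r) (2 * (p - 1)) x) * eucNorm (x - y)) := by gcongr
    _ = _ := by ring

lemma lorSum_ge {n : ℕ} {r p : ℝ} (hr : 0 ≤ r) (hp : 0 ≤ p) (x : Fin n → ℝ) :
    (n : ℝ) ^ (-r) * ∑ j, |x j| ^ p ≤ lorSum r p x := by
  refine le_trans ?_ (sum_perm_le_lorSum hr hp x 1)
  rw [Finset.mul_sum]
  refine Finset.sum_le_sum fun i _ => ?_
  have : (i : ℝ) + 1 ≤ n := by exact_mod_cast i.2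
  simp only [Equiv.Perm.coe_one, id]
  exact mul_le_mul_of_nonneg_right
    (Real.rpow_le_rpow_of_nonpos (by positivity) this (by linarith)) (by positivity)

lemma decRe_sq_le {n : ℕ} (x : Fin n → ℝ) {S : ℝ} (h : ∑ j, Real.exp (x j ^ 2 / 4) ≤ S)
    (i : Fin n) : decRe x i ^ 2 ≤ 4 * Real.log (S / ((i : ℝ) + 1)) := by
  obtain ⟨σ, hσ⟩ := decRe_eq_perm x
  have h1 : ∑ j, Real.exp (decRe x j ^ 2 / 4) = ∑ j, Real.exp (x j ^ 2 / 4) := by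
    simp only [hσ, sq_abs]
    exact Equiv.sum_comp σ fun j => Real.exp (x j ^ 2 / 4)
  have h2 : ((i : ℝ) + 1) * Real.exp (decRe x i ^ 2 / 4) ≤ S := by
    calc ((i : ℝ) + 1) * Real.exp (decRe x i ^ 2 / 4)
        = ∑ j ∈ Finset.Iic i, Real.exp (decRe x i ^ 2 / 4) := by simp
      _ ≤ ∑ j ∈ Finset.Iic i, Real.exp (decRe x j ^ 2 / 4) := by
          refine Finset.sum_le_sum fun j hj => ?_
          have := decRe_antitone x (Finset.mem_Iic.1 hj)
          have := decRe_nonneg x i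
          gcongr
      _ ≤ ∑ j, Real.exp (decRe x j ^ 2 / 4) :=
          Finset.sum_le_sum_of_subset_of_nonneg (Finset.subset_univ _) fun _ _ _ =>
            (Real.exp_pos _).le
      _ ≤ S := h1.trans_le h
  have h3 : Real.exp (decRe x i ^ 2 / 4) ≤ S / ((i : ℝ) + 1) := by
    rw [le_div_iff₀ (by positivity)]; linarith
  have h4 := (Real.le_log_iff_exp_le ((Real.exp_pos _).trans_le h3)).2 h3
  linarith

/-- The `q`-th power of the Lipschitz constant of the Lorentz norm with exponents `(2r, q)`,
`q = 2(p - 1)`, with respect to the Euclidean norm. -/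
noncomputable def lipPow (n : ℕ) (r p : ℝ) : ℝ :=
  if 2 ≤ p then 1 else (∑ i : Fin n, ((i : ℝ) + 1) ^ (-(2 * r / (2 - p)))) ^ (2 - p)

lemma lipPow_nonneg (n : ℕ) (r p : ℝ) : 0 ≤ lipPow n r p := by
  unfold lipPow; split_ifs <;> positivity

lemma lorSum_le_lipPow {n : ℕ} {r p : ℝ} (hr : 0 ≤ r) (hp : 3 / 2 ≤ p) (x : Fin n → ℝ) :
    lorSum (2 * r) (2 * (p - 1)) x ≤ lipPow n r p * eucNorm x ^ (2 * (p - 1)) := by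
  obtain ⟨σ, hσ⟩ := exists_perm_lorSum_eq x
  have hE : ∀ i, |x (σ i)| ≤ eucNorm x := fun i => by
    rw [← sum_sq_perm x σ]
    refine Real.le_sqrt_of_sq_le ?_
    exact Finset.single_le_sum (f := fun i => |x (σ i)| ^ 2) (fun i _ => by positivity)
      (Finset.mem_univ i)
  have hsq : ∑ i, |x (σ i)| ^ (2 : ℝ) = eucNorm x ^ (2 : ℝ) := by
    rw [← sum_sq_perm x σ, Real.rpow_two, Real.sq_sqrt (by positivity)]
    simp
  unfold lipPow
  split_ifs with h2
  · rw [hσ, one_mul]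
    calc _ ≤ ∑ i : Fin n, |x (σ i)| ^ (2 : ℝ) * eucNorm x ^ (2 * (p - 1) - 2) := by
          refine Finset.sum_le_sum fun i _ => ?_
          have h5 : |x (σ i)| ^ (2 * (p - 1)) =
              |x (σ i)| ^ (2 : ℝ) * |x (σ i)| ^ (2 * (p - 1) - 2) := by
            rw [← Real.rpow_add_of_nonneg (abs_nonneg _) (by norm_num) (by linarith)]
            ring_nf
          have h6 : ((i : ℝ) + 1) ^ (-(2 * r)) ≤ 1 :=
            Real.rpow_le_one_of_one_le_of_nonpos (by linarith [Nat.cast_nonneg (α := ℝ) (i : ℕ)])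
              (by linarith)
          calc _ ≤ 1 * |x (σ i)| ^ (2 * (p - 1)) := by gcongr
            _ = |x (σ i)| ^ (2 : ℝ) * |x (σ i)| ^ (2 * (p - 1) - 2) := by rw [one_mul, h5]
            _ ≤ _ := mul_le_mul_of_nonneg_left
              (Real.rpow_le_rpow (abs_nonneg _) (hE i) (by linarith)) (by positivity)
      _ = _ := by
          rw [← Finset.sum_mul, hsq,
            ← Real.rpow_add_of_nonneg (eucNorm_nonneg x) (by norm_num) (by linarith)]
          ring_nf
  · push Not at h2
    rw [hσ]
    have hconj : (1 / (2 - p)).HolderConjugate (1 / (p - 1)) := by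
      rw [Real.holderConjugate_iff]
      constructor
      · rw [lt_div_iff₀] <;> linarith
      · simp; ring
    have h7 := Real.inner_le_Lp_mul_Lq_of_nonneg Finset.univ
      (f := fun i : Fin n => ((i : ℝ) + 1) ^ (-(2 * r)))
      (g := fun i : Fin n => |x (σ i)| ^ (2 * (p - 1))) hconj
      (fun i _ => by positivity) (fun i _ => by positivity)
    have hp1 : p - 1 ≠ 0 := by linarith
    have hp2 : 2 - p ≠ 0 := by linarith
    have h8 : ∀ i : Fin n, (|x (σ i)| ^ (2 * (p - 1))) ^ (1 / (p - 1)) = |x (σ i)| ^ (2 : ℝ) := by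
      intro i
      rw [← Real.rpow_mul (abs_nonneg _)]
      congr 1; field_simp
    have h9 : ∀ i : Fin n, (((i : ℝ) + 1) ^ (-(2 * r))) ^ (1 / (2 - p)) =
        ((i : ℝ) + 1) ^ (-(2 * r / (2 - p))) := by
      intro i
      rw [← Real.rpow_mul (by positivity)]
      congr 1; field_simp
    simp only [h8, h9, one_div_one_div] at h7
    rw [hsq, ← Real.rpow_mul (eucNorm_nonneg x)] at h7
    exact h7

lemma lorNorm_lip {n : ℕ} {r p : ℝ} (hr : 0 ≤ r) (hp : 3 / 2 ≤ p) (x y : Fin n → ℝ) :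
    |lorNorm (2 * r) (2 * (p - 1)) x - lorNorm (2 * r) (2 * (p - 1)) y| ≤
      lipPow n r p ^ (1 / (2 * (p - 1))) * eucNorm (x - y) := by
  have hq : 0 < 2 * (p - 1) := by linarith
  have key : ∀ x y : Fin n → ℝ, lorNorm (2 * r) (2 * (p - 1)) x -
      lorNorm (2 * r) (2 * (p - 1)) y ≤ lipPow n r p ^ (1 / (2 * (p - 1))) * eucNorm (x - y) := by
    intro x y
    have h1 := lorNorm_le_add_sub (by linarith : 0 ≤ 2 * r) (by linarith : 1 ≤ 2 * (p - 1)) x y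
    have h2 : lorNorm (2 * r) (2 * (p - 1)) (x - y) ≤
        lipPow n r p ^ (1 / (2 * (p - 1))) * eucNorm (x - y) := by
      have h3 := Real.rpow_le_rpow (lorSum_nonneg _ _ _) (lorSum_le_lipPow hr hp (x - y))
        (by positivity : 0 ≤ 1 / (2 * (p - 1)))
      rw [Real.mul_rpow (lipPow_nonneg _ _ _) (Real.rpow_nonneg (eucNorm_nonneg _) _),
        ← Real.rpow_mul (eucNorm_nonneg _), mul_one_div_cancel hq.ne', Real.rpow_one] at h3
      exact h3
    linarith
  have hsymm : eucNorm (y - x) = eucNorm (x - y) := by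
    simp only [eucNorm, Pi.sub_apply]
    congr 1
    exact Finset.sum_congr rfl fun i _ => by ring
  rw [abs_le]
  constructor
  · have := key y x
    rw [hsymm] at this
    linarith
  · exact key x y

instance isProbabilityMeasure_stdGaussian (n : ℕ) :
    IsProbabilityMeasure (_root_.stdGaussian n) := by
  unfold _root_.stdGaussian; infer_instance

instance isProbabilityMeasure_gaussMatrix (n k : ℕ) : IsProbabilityMeasure (gaussMatrix n k) := by
  unfold gaussMatrix; infer_instance

lemma integral_cexp_gaussianReal (c : ℝ) :
    ∫ v : ℝ, Complex.exp (((c * v : ℝ) : ℂ) * Complex.I) ∂(gaussianReal 0 1) =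
      Complex.exp (-((c : ℂ) ^ 2 / 2)) := by
  have := charFun_gaussianReal (μ := 0) (v := 1) c
  rw [charFun_apply_real] at this
  push_cast at this ⊢
  rw [this]
  congr 1
  ring

lemma integral_cexp_stdGaussian {k : ℕ} (c : Fin k → ℝ) :
    ∫ g, Complex.exp (((∑ j, c j * g j : ℝ) : ℂ) * Complex.I) ∂(_root_.stdGaussian k) =
      Complex.exp (-(((∑ j, c j ^ 2 : ℝ) : ℂ) / 2)) := by
  have h : ∀ g : Fin k → ℝ, Complex.exp (((∑ j, c j * g j : ℝ) : ℂ) * Complex.I) =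
      ∏ j, Complex.exp (((c j * g j : ℝ) : ℂ) * Complex.I) := by
    intro g
    rw [← Complex.exp_sum]
    congr 1
    push_cast
    rw [Finset.sum_mul]
  simp only [h, _root_.stdGaussian]
  rw [integral_fintype_prod_eq_prod
    (f := fun (j : Fin k) (v : ℝ) => Complex.exp (((c j * v : ℝ) : ℂ) * Complex.I))]
  simp only [integral_cexp_gaussianReal]
  rw [← Complex.exp_sum]
  congr 1
  push_cast
  rw [Finset.sum_neg_distrib, Finset.sum_div]

lemma map_row_pair {k : ℕ} (x z : Fin k → ℝ) (hx : ∑ j, x j ^ 2 = 1) (hz : ∑ j, z j ^ 2 = 1)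
    (hxz : ∑ j, x j * z j = 0) :
    (_root_.stdGaussian k).map (fun g => (∑ j, g j * x j, ∑ j, g j * z j)) =
      (gaussianReal 0 1).prod (gaussianReal 0 1) := by
  have hmeas : Measurable fun g : Fin k → ℝ => (∑ j, g j * x j, ∑ j, g j * z j) := by fun_prop
  have := Measure.isProbabilityMeasure_map (μ := _root_.stdGaussian k) hmeas.aemeasurable
  refine Measure.ext_of_charFunDual ?_
  ext L
  have hL : ∀ a b : ℝ, L (a, b) = L (1, 0) * a + L (0, 1) * b := by
    intro a b
    have : ((a, b) : ℝ × ℝ) = a • (1, 0) + b • (0, 1) := by simp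
    rw [this, map_add, map_smul, map_smul, smul_eq_mul, smul_eq_mul]
    ring
  rw [charFunDual_prod]
  simp only [charFunDual_apply]
  rw [integral_map hmeas.aemeasurable (by fun_prop)]
  have h1 : ∀ v : ℝ, (L.comp (.inl ℝ ℝ ℝ)) v = L (1, 0) * v := fun v => by
    simp [hL v 0]
  have h2 : ∀ v : ℝ, (L.comp (.inr ℝ ℝ ℝ)) v = L (0, 1) * v := fun v => by
    simp [hL 0 v]
  simp only [h1, h2]
  rw [integral_cexp_gaussianReal, integral_cexp_gaussianReal, ← Complex.exp_add]
  have h3 : ∀ g : Fin k → ℝ, L (∑ j, g j * x j, ∑ j, g j * z j) =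
      ∑ j, (L (1, 0) * x j + L (0, 1) * z j) * g j := by
    intro g
    rw [hL, Finset.mul_sum, Finset.mul_sum, ← Finset.sum_add_distrib]
    exact Finset.sum_congr rfl fun j _ => by ring
  simp only [h3]
  rw [integral_cexp_stdGaussian]
  congr 1
  have h4 : ∑ j, (L (1, 0) * x j + L (0, 1) * z j) ^ 2 = L (1, 0) ^ 2 + L (0, 1) ^ 2 := by
    calc _ = L (1, 0) ^ 2 * ∑ j, x j ^ 2 + L (0, 1) ^ 2 * ∑ j, z j ^ 2 +
          2 * L (1, 0) * L (0, 1) * ∑ j, x j * z j := by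
          rw [Finset.mul_sum, Finset.mul_sum, Finset.mul_sum, ← Finset.sum_add_distrib,
            ← Finset.sum_add_distrib]
          exact Finset.sum_congr rfl fun j _ => by ring
      _ = _ := by rw [hx, hz, hxz]; ring
  rw [h4]
  push_cast
  ring

lemma measurePreserving_mulVec_pair (n : ℕ) {k : ℕ} (x z : Fin k → ℝ) (hx : ∑ j, x j ^ 2 = 1)
    (hz : ∑ j, z j ^ 2 = 1) (hxz : ∑ j, x j * z j = 0) :
    MeasurePreserving (fun g => (mulVec g x, mulVec g z)) (gaussMatrix n k)
      ((_root_.stdGaussian n).prod (_root_.stdGaussian n)) := by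
  have h1 : MeasurePreserving (fun g : Fin k → ℝ => (∑ j, g j * x j, ∑ j, g j * z j))
      (_root_.stdGaussian k) ((gaussianReal 0 1).prod (gaussianReal 0 1)) :=
    ⟨by fun_prop, map_row_pair x z hx hz hxz⟩
  have h2 := measurePreserving_pi (fun _ : Fin n => _root_.stdGaussian k)
    (fun _ : Fin n => (gaussianReal 0 1).prod (gaussianReal 0 1)) (fun _ => h1)
  have h3 := measurePreserving_arrowProdEquivProdArrow ℝ ℝ (Fin n)
    (fun _ => gaussianReal 0 1) (fun _ => gaussianReal 0 1)
  exact h3.comp h2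

lemma measurePreserving_mulVec (n : ℕ) {k : ℕ} (x : Fin k → ℝ) (hx : ∑ j, x j ^ 2 = 1) :
    MeasurePreserving (fun g => mulVec g x) (gaussMatrix n k) (_root_.stdGaussian n) := by
  have h1 : MeasurePreserving (fun g : Fin k → ℝ => ∑ j, g j * x j)
      (_root_.stdGaussian k) (gaussianReal 0 1) := by
    have hm : Measurable fun g : Fin k → ℝ => ∑ j, g j * x j := by fun_prop
    refine ⟨hm, ?_⟩
    have := Measure.isProbabilityMeasure_map (μ := _root_.stdGaussian k) hm.aemeasurable
    refine Measure.ext_of_charFun ?_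
    ext t
    rw [charFun_apply_real, integral_map hm.aemeasurable (by fun_prop), charFun_gaussianReal]
    have := integral_cexp_stdGaussian fun j => t * x j
    simp only [mul_pow, ← Finset.mul_sum, hx] at this
    convert this using 2
    · ext g
      push_cast
      rw [Finset.mul_sum]
      congr 2
      exact Finset.sum_congr rfl fun j _ => by ring
    · push_cast; ring
  exact measurePreserving_pi (fun _ : Fin n => _root_.stdGaussian k)
    (fun _ : Fin n => gaussianReal 0 1) (fun _ => h1)

lemma lintegral_exp_linear {k : ℕ} (c : Fin k → ℝ) :
    ∫⁻ g, ENNReal.ofReal (Real.exp (∑ j, c j * g j)) ∂(_root_.stdGaussian k) =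
      ENNReal.ofReal (Real.exp ((∑ j, c j ^ 2) / 2)) := by
  have h : ∀ g : Fin k → ℝ, Real.exp (∑ j, c j * g j) = ∏ j, Real.exp (c j * g j) :=
    fun g => Real.exp_sum _ _
  have h1 : ∀ t : ℝ, ∫ v, Real.exp (t * v) ∂(gaussianReal 0 1) = Real.exp (t ^ 2 / 2) := by
    intro t
    have := mgf_gaussianReal (p := gaussianReal 0 1) (X := id) (μ := 0) (v := 1) (by simp) t
    simpa [mgf] using this
  have h_int : Integrable (fun g : Fin k → ℝ => ∏ j, Real.exp (c j * g j))
      (_root_.stdGaussian k) :=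
    Integrable.fintype_prod (f := fun (j : Fin k) (v : ℝ) => Real.exp (c j * v))
      fun j => integrable_exp_mul_gaussianReal (c j)
  simp only [h]
  rw [← ofReal_integral_eq_lintegral_ofReal h_int
    (Filter.Eventually.of_forall fun g => Finset.prod_nonneg fun j _ => (Real.exp_pos _).le)]
  congr 1
  rw [_root_.stdGaussian, integral_fintype_prod_eq_prod
    (f := fun (j : Fin k) (v : ℝ) => Real.exp (c j * v))]
  simp only [h1]
  rw [← Real.exp_sum, Finset.sum_div]

lemma gaussianReal_le_volume (s : Set ℝ) : gaussianReal 0 1 s ≤ volume s := by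
  rw [gaussianReal_apply 0 (by norm_num) s]
  calc ∫⁻ x in s, gaussianPDF 0 1 x ≤ ∫⁻ _ in s, 1 := by
        refine lintegral_mono fun x => ?_
        rw [gaussianPDF, ← ENNReal.ofReal_one]
        refine ENNReal.ofReal_le_ofReal ?_
        rw [gaussianPDFReal]
        have h1 : (Real.sqrt (2 * Real.pi * (1 : NNReal)))⁻¹ ≤ 1 := by
          refine inv_le_one_of_one_le₀ (Real.one_le_sqrt.2 ?_)
          have := Real.pi_gt_three
          push_cast
          linarith
        have h2 : Real.exp (-(x - 0) ^ 2 / (2 * (1 : NNReal))) ≤ 1 := by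
          rw [Real.exp_le_one_iff]
          have : 0 ≤ (x - 0) ^ 2 := sq_nonneg _
          push_cast
          linarith
        calc _ ≤ (1 : ℝ) * 1 := mul_le_mul h1 h2 (Real.exp_pos _).le (by norm_num)
          _ = 1 := by norm_num
    _ = volume s := by simp

lemma stdGaussian_absolutelyContinuous (n : ℕ) :
    _root_.stdGaussian n ≪ (volume : Measure (Fin n → ℝ)) := by
  have hle : (_root_.stdGaussian n).toOuterMeasure ≤
      OuterMeasure.pi fun _ : Fin n => (volume : Measure ℝ).toOuterMeasure := by
    rw [OuterMeasure.le_pi]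
    intro s _
    change Measure.pi (fun _ : Fin n => gaussianReal 0 1) (Set.univ.pi s) ≤ _
    rw [Measure.pi_pi]
    exact Finset.prod_le_prod' fun i _ => gaussianReal_le_volume _
  intro s hs
  refine le_antisymm ((hle s).trans ?_) (zero_le)
  rw [← hs, volume_pi, Measure.pi]
  exact le_toMeasure_apply _ _ _

lemma eucNorm_sub_comm {k : ℕ} (x y : Fin k → ℝ) : eucNorm (x - y) = eucNorm (y - x) := by
  simp only [eucNorm, Pi.sub_apply]
  congr 1
  exact Finset.sum_congr rfl fun i _ => by ring

lemma eucNorm_add_le {k : ℕ} (x y : Fin k → ℝ) : eucNorm (x + y) ≤ eucNorm x + eucNorm y := by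
  simp only [eucNorm_eq_norm, WithLp.toLp_add]
  exact norm_add_le _ _

lemma eucNorm_smul {k : ℕ} (t : ℝ) (x : Fin k → ℝ) : eucNorm (t • x) = |t| * eucNorm x := by
  simp only [eucNorm_eq_norm, WithLp.toLp_smul, norm_smul, Real.norm_eq_abs]

lemma eucNorm_sq {k : ℕ} (x : Fin k → ℝ) : eucNorm x ^ 2 = ∑ j, x j ^ 2 :=
  Real.sq_sqrt (Finset.sum_nonneg fun _ _ => sq_nonneg _)

lemma eucNorm_le_sum_abs {k : ℕ} (x : Fin k → ℝ) : eucNorm x ≤ ∑ j, |x j| := by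
  refine Real.sqrt_le_iff.2 ⟨Finset.sum_nonneg fun _ _ => abs_nonneg _, ?_⟩
  simp only [← sq_abs (x _)]
  exact Finset.sum_sq_le_sq_sum_of_nonneg fun i _ => abs_nonneg (x i)

/-- Lipschitz continuity with respect to the Euclidean norm. -/
def EucLip {n : ℕ} (Λ : ℝ) (F : (Fin n → ℝ) → ℝ) : Prop :=
  ∀ x y, |F x - F y| ≤ Λ * eucNorm (x - y)

lemma EucLip.neg {n : ℕ} {Λ : ℝ} {F : (Fin n → ℝ) → ℝ} (hF : EucLip Λ F) :
    EucLip Λ fun x => -F x := fun x y => by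
  rw [← neg_sub', abs_neg]
  exact hF x y

lemma EucLip.lipschitzWith {n : ℕ} {Λ : ℝ} (hΛ : 0 ≤ Λ) {F : (Fin n → ℝ) → ℝ}
    (hF : EucLip Λ F) : LipschitzWith (Real.toNNReal (Λ * n)) F := by
  refine LipschitzWith.of_dist_le_mul fun x y => ?_
  rw [Real.dist_eq, dist_eq_norm]
  refine (hF x y).trans ?_
  have h1 : ∑ j, |(x - y) j| ≤ n * ‖x - y‖ := by
    calc ∑ j, |(x - y) j| ≤ ∑ _j : Fin n, ‖x - y‖ :=
          Finset.sum_le_sum fun j _ => norm_le_pi_norm (x - y) j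
      _ = n * ‖x - y‖ := by simp
  calc Λ * eucNorm (x - y) ≤ Λ * (n * ‖x - y‖) := by
        gcongr
        exact (eucNorm_le_sum_abs _).trans h1
    _ = _ := by rw [Real.coe_toNNReal _ (by positivity)]; ring

lemma EucLip.continuous {n : ℕ} {Λ : ℝ} (hΛ : 0 ≤ Λ) {F : (Fin n → ℝ) → ℝ}
    (hF : EucLip Λ F) : Continuous F := (hF.lipschitzWith hΛ).continuous

lemma EucLip.abs_fderiv_le {n : ℕ} {Λ : ℝ} (hΛ : 0 ≤ Λ) {F : (Fin n → ℝ) → ℝ}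
    (hF : EucLip Λ F) (x v : Fin n → ℝ) : |fderiv ℝ F x v| ≤ Λ * eucNorm v := by
  by_cases hd : DifferentiableAt ℝ F x
  · have h1 : HasDerivAt (fun t : ℝ => F (x + t • v)) (fderiv ℝ F x v) 0 :=
      hd.hasFDerivAt.hasLineDerivAt v
    have h2 := h1.tendsto_slope_zero
    refine le_of_tendsto h2.abs (eventually_mem_nhdsWithin.mono fun t ht => ?_)
    have ht' : t ≠ 0 := ht
    have h3 := hF (x + t • v) x
    rw [add_sub_cancel_left, eucNorm_smul] at h3
    simp only [zero_add, zero_smul, add_zero, smul_eq_mul, abs_mul, abs_inv]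
    rw [inv_mul_le_iff₀ (abs_pos.2 ht')]
    linarith
  · rw [fderiv_zero_of_not_differentiableAt hd]
    simp only [zero_apply, abs_zero]
    exact mul_nonneg hΛ (eucNorm_nonneg v)

lemma EucLip.sum_fderiv_sq_le {n : ℕ} {Λ : ℝ} (hΛ : 0 ≤ Λ) {F : (Fin n → ℝ) → ℝ}
    (hF : EucLip Λ F) (x : Fin n → ℝ) :
    ∑ j, (fderiv ℝ F x (Pi.single j 1)) ^ 2 ≤ Λ ^ 2 := by
  set a : Fin n → ℝ := fun j => fderiv ℝ F x (Pi.single j 1) with ha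
  have h1 : fderiv ℝ F x a = ∑ j, a j ^ 2 := by
    conv_lhs => rw [pi_eq_sum_univ' a]
    rw [map_sum]
    refine Finset.sum_congr rfl fun j _ => ?_
    rw [map_smul, smul_eq_mul, sq]
  have h2 := hF.abs_fderiv_le hΛ x a
  rw [h1, ← eucNorm_sq, abs_of_nonneg (sq_nonneg _)] at h2
  rw [← eucNorm_sq]
  rcases (eucNorm_nonneg a).eq_or_lt with h0 | h0
  · rw [← h0, zero_pow two_ne_zero]; positivity
  · have : eucNorm a ≤ Λ := by
      by_contra hcon
      nlinarith
    gcongr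

lemma fderiv_apply_eq_sum {n : ℕ} (F : (Fin n → ℝ) → ℝ) (x y : Fin n → ℝ) :
    fderiv ℝ F x y = ∑ j, fderiv ℝ F x (Pi.single j 1) * y j := by
  conv_lhs => rw [pi_eq_sum_univ' y]
  rw [map_sum]
  refine Finset.sum_congr rfl fun j _ => ?_
  rw [map_smul, smul_eq_mul, mul_comm]

lemma lintegral_exp_fderiv_le {n : ℕ} {Λ : ℝ} (hΛ : 0 ≤ Λ) {F : (Fin n → ℝ) → ℝ}
    (hF : EucLip Λ F) (s : ℝ) :
    ∫⁻ P, ENNReal.ofReal (Real.exp (s * fderiv ℝ F P.1 P.2))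
      ∂((_root_.stdGaussian n).prod (_root_.stdGaussian n)) ≤
      ENNReal.ofReal (Real.exp (s ^ 2 * Λ ^ 2 / 2)) := by
  have heq : ∀ P : (Fin n → ℝ) × (Fin n → ℝ),
      ENNReal.ofReal (Real.exp (s * fderiv ℝ F P.1 P.2)) = ENNReal.ofReal
        (Real.exp (s * ∑ j, fderiv ℝ F P.1 (Pi.single j 1) * P.2 j)) := fun P => by
    rw [fderiv_apply_eq_sum]
  rw [lintegral_congr heq]
  have hm : Measurable fun P : (Fin n → ℝ) × (Fin n → ℝ) =>
      ENNReal.ofReal (Real.exp (s * ∑ j, fderiv ℝ F P.1 (Pi.single j 1) * P.2 j)) := by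
    have : ∀ j, Measurable fun P : (Fin n → ℝ) × (Fin n → ℝ) =>
        fderiv ℝ F P.1 (Pi.single j 1) := fun j =>
      (measurable_fderiv_apply_const ℝ F (Pi.single j 1)).comp measurable_fst
    fun_prop
  rw [lintegral_prod _ hm.aemeasurable]
  calc _ ≤ ∫⁻ _ : Fin n → ℝ, ENNReal.ofReal (Real.exp (s ^ 2 * Λ ^ 2 / 2))
        ∂(_root_.stdGaussian n) := by
        refine lintegral_mono fun x => ?_
        have := lintegral_exp_linear fun j => s * fderiv ℝ F x (Pi.single j 1)
        simp only [mul_assoc, ← Finset.mul_sum] at this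
        simp only [this]
        refine ENNReal.ofReal_le_ofReal (Real.exp_le_exp.2 ?_)
        simp only [mul_pow, ← Finset.mul_sum]
        have := hF.sum_fderiv_sq_le hΛ x
        gcongr
    _ = _ := by simp

lemma lintegral_exp_sum_abs_lt_top (n : ℕ) (c : ℝ) :
    ∫⁻ g, ENNReal.ofReal (Real.exp (c * ∑ j, |g j|)) ∂(_root_.stdGaussian n) < ⊤ := by
  have h_int : Integrable (fun g : Fin n → ℝ => ∏ j, Real.exp (c * |g j|))
      (_root_.stdGaussian n) := by
    refine Integrable.fintype_prod (f := fun (j : Fin n) (v : ℝ) => Real.exp (c * |v|))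
      fun j => ?_
    refine Integrable.mono' ((integrable_exp_mul_gaussianReal (μ := 0) (v := 1) c).add
      (integrable_exp_mul_gaussianReal (-c))) (by fun_prop) (Filter.Eventually.of_forall fun v => ?_)
    rw [Real.norm_eq_abs, abs_of_pos (Real.exp_pos _)]
    simp only [Pi.add_apply]
    rcases abs_cases v with ⟨h, _⟩ | ⟨h, _⟩ <;> rw [h]
    · linarith [Real.exp_pos (-c * v)]
    · rw [show c * -v = -c * v by ring]
      linarith [Real.exp_pos (c * v)]
  have h : ∀ g : Fin n → ℝ, Real.exp (c * ∑ j, |g j|) = ∏ j, Real.exp (c * |g j|) := by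
    intro g
    rw [Finset.mul_sum, Real.exp_sum]
  simp only [h]
  exact h_int.lintegral_lt_top

lemma tendsto_lintegral_rotation {n : ℕ} {Λ : ℝ} (hΛ : 0 ≤ Λ) {F : (Fin n → ℝ) → ℝ}
    (hF : EucLip Λ F) (s θ : ℝ) :
    Filter.Tendsto (fun N : ℕ => ∫⁻ P, ENNReal.ofReal (Real.exp (N * (s *
        (F (Real.cos (θ / N) • P.1 + Real.sin (θ / N) • P.2) - F P.1))))
        ∂((_root_.stdGaussian n).prod (_root_.stdGaussian n))) Filter.atTop
      (nhds (∫⁻ P, ENNReal.ofReal (Real.exp (s * θ * fderiv ℝ F P.1 P.2))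
        ∂((_root_.stdGaussian n).prod (_root_.stdGaussian n)))) := by
  have hFc := hF.continuous hΛ
  set K : ℝ := |s| * Λ * |θ| with hK
  refine tendsto_lintegral_of_dominated_convergence'
    (fun P => ENNReal.ofReal (Real.exp (K * ∑ j, |P.1 j|)) *
      ENNReal.ofReal (Real.exp (K * ∑ j, |P.2 j|))) ?_ ?_ ?_ ?_
  · intro N
    refine Measurable.aemeasurable ?_
    refine (ENNReal.continuous_ofReal.comp ?_).measurable
    fun_prop
  · intro N
    refine Filter.Eventually.of_forall fun P => ?_
    simp only
    rw [← ENNReal.ofReal_mul (Real.exp_pos _).le, ← Real.exp_add]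
    refine ENNReal.ofReal_le_ofReal (Real.exp_le_exp.2 ?_)
    have h1 := hF (Real.cos (θ / N) • P.1 + Real.sin (θ / N) • P.2) P.1
    have h2 : Real.cos (θ / N) • P.1 + Real.sin (θ / N) • P.2 - P.1 =
        (Real.cos (θ / N) - 1) • P.1 + Real.sin (θ / N) • P.2 := by
      module
    have h3 : |Real.cos (θ / N) - 1| ≤ |θ / N| := by
      have := Real.abs_cos_sub_cos_le (θ / N) 0
      simpa using this
    have h4 : |Real.sin (θ / N)| ≤ |θ / N| := Real.abs_sin_le_abs
    have h5 : eucNorm ((Real.cos (θ / N) - 1) • P.1 + Real.sin (θ / N) • P.2) ≤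
        |θ / N| * (∑ j, |P.1 j| + ∑ j, |P.2 j|) := by
      refine (eucNorm_add_le _ _).trans ?_
      rw [eucNorm_smul, eucNorm_smul, mul_add]
      exact add_le_add (mul_le_mul h3 (eucNorm_le_sum_abs _) (eucNorm_nonneg _) (abs_nonneg _))
        (mul_le_mul h4 (eucNorm_le_sum_abs _) (eucNorm_nonneg _) (abs_nonneg _))
    rw [h2] at h1
    have h6 : (N : ℝ) * |θ / N| ≤ |θ| := by
      rw [abs_div, Nat.abs_cast]
      rcases (Nat.cast_nonneg (α := ℝ) N).eq_or_lt with h0 | h0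
      · rw [← h0]; simp
      · rw [mul_div_cancel₀ _ h0.ne']
    have h7 : 0 ≤ ∑ j, |P.1 j| + ∑ j, |P.2 j| :=
      add_nonneg (Finset.sum_nonneg fun _ _ => abs_nonneg _)
        (Finset.sum_nonneg fun _ _ => abs_nonneg _)
    calc N * (s * (F (Real.cos (θ / N) • P.1 + Real.sin (θ / N) • P.2) - F P.1))
        ≤ N * (|s| * |F (Real.cos (θ / N) • P.1 + Real.sin (θ / N) • P.2) - F P.1|) := by
          rw [← abs_mul]
          gcongr
          exact le_abs_self _
      _ ≤ N * (|s| * (Λ * (|θ / N| * (∑ j, |P.1 j| + ∑ j, |P.2 j|)))) := by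
          gcongr
          exact h1.trans (by gcongr)
      _ = |s| * Λ * (N * |θ / N|) * (∑ j, |P.1 j| + ∑ j, |P.2 j|) := by ring
      _ ≤ |s| * Λ * |θ| * (∑ j, |P.1 j| + ∑ j, |P.2 j|) := by gcongr
      _ = _ := by rw [hK]; ring
  · have hm : Measurable fun g : Fin n → ℝ => ENNReal.ofReal (Real.exp (K * ∑ j, |g j|)) := by
      refine (ENNReal.continuous_ofReal.comp ?_).measurable
      fun_prop
    rw [lintegral_prod_mul hm.aemeasurable hm.aemeasurable]
    exact ENNReal.mul_ne_top (lintegral_exp_sum_abs_lt_top n K).ne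
      (lintegral_exp_sum_abs_lt_top n K).ne
  · have h1 : ∀ᵐ x ∂(_root_.stdGaussian n), DifferentiableAt ℝ F x :=
      (stdGaussian_absolutelyContinuous n).ae_le (hF.lipschitzWith hΛ).ae_differentiableAt
    have h2 := Measure.quasiMeasurePreserving_fst (μ := _root_.stdGaussian n)
      (ν := _root_.stdGaussian n) |>.ae h1
    filter_upwards [h2] with P hP
    have h3 : HasDerivAt (fun t : ℝ => Real.cos (θ * t) • P.1 + Real.sin (θ * t) • P.2)
        (θ • P.2) 0 := by
      have hl : HasDerivAt (fun t : ℝ => θ * t) θ 0 := by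
        simpa using (hasDerivAt_id (0 : ℝ)).const_mul θ
      have hc := (hl.cos.smul_const P.1).fun_add (hl.sin.smul_const P.2)
      simpa using hc
    have h4 : HasDerivAt (fun t : ℝ => F (Real.cos (θ * t) • P.1 + Real.sin (θ * t) • P.2))
        (θ * fderiv ℝ F P.1 P.2) 0 := by
      have h5 : HasFDerivAt F (fderiv ℝ F P.1)
          (Real.cos (θ * 0) • P.1 + Real.sin (θ * 0) • P.2) := by
        simpa using hP.hasFDerivAt
      have := h5.comp_hasDerivAt (0 : ℝ) h3
      rw [map_smul, smul_eq_mul] at this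
      exact this
    have h6 := h4.tendsto_slope_zero
    have h7 : Filter.Tendsto (fun N : ℕ => ((N : ℝ))⁻¹) Filter.atTop (nhdsWithin 0 {0}ᶜ) := by
      refine tendsto_nhdsWithin_iff.2 ⟨tendsto_inv_atTop_nhds_zero_nat, ?_⟩
      filter_upwards [Filter.eventually_gt_atTop 0] with N hN
      have : (N : ℝ) ≠ 0 := by positivity
      simpa using hN.ne'
    have h8 := h6.comp h7
    have h9 : Filter.Tendsto (fun N : ℕ => (N * (s *
        (F (Real.cos (θ / N) • P.1 + Real.sin (θ / N) • P.2) - F P.1))) ) Filter.atTop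
        (nhds (s * (θ * fderiv ℝ F P.1 P.2))) := by
      refine (h8.const_mul s).congr fun N => ?_
      simp [div_eq_mul_inv]
      ring
    rw [← mul_assoc] at h9
    exact (ENNReal.continuous_ofReal.tendsto _).comp ((Real.continuous_exp.tendsto _).comp h9)

lemma mulVec_add_smul {n k : ℕ} (g : Fin n → Fin k → ℝ) (a b : ℝ) (x z : Fin k → ℝ) :
    mulVec g (a • x + b • z) = a • mulVec g x + b • mulVec g z := by
  ext i
  simp only [mulVec, Pi.add_apply, Pi.smul_apply, smul_eq_mul, Finset.mul_sum,
    ← Finset.sum_add_distrib]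
  exact Finset.sum_congr rfl fun j _ => by ring

lemma mulVec_smul {n k : ℕ} (g : Fin n → Fin k → ℝ) (a : ℝ) (x : Fin k → ℝ) :
    mulVec g (a • x) = a • mulVec g x := by
  simpa using mulVec_add_smul g a 0 x 0

lemma continuous_mulVec_right {n k : ℕ} (g : Fin n → Fin k → ℝ) : Continuous (mulVec g) := by
  unfold mulVec; fun_prop

lemma continuous_mulVec_left {n k : ℕ} (x : Fin k → ℝ) :
    Continuous fun g : Fin n → Fin k → ℝ => mulVec g x := by
  unfold mulVec; fun_prop

lemma exp_sum_le_average {N : ℕ} (hN : 0 < N) (d : ℕ → ℝ) :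
    Real.exp (∑ m ∈ Finset.range N, d m) ≤
      ∑ m ∈ Finset.range N, (N : ℝ)⁻¹ * Real.exp (N * d m) := by
  have hN' : (N : ℝ) ≠ 0 := by positivity
  have := convexOn_exp.map_sum_le (t := Finset.range N) (w := fun _ => (N : ℝ)⁻¹)
    (p := fun m => N * d m) (fun _ _ => by positivity) (by simp [hN'])
    (fun _ _ => Set.mem_univ _)
  simpa [hN'] using this

lemma lintegral_exp_rotation_le {n k : ℕ} {Λ : ℝ} (hΛ : 0 ≤ Λ) {F : (Fin n → ℝ) → ℝ}
    (hF : EucLip Λ F) (x z : Fin k → ℝ) (hx : ∑ j, x j ^ 2 = 1) (hz : ∑ j, z j ^ 2 = 1)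
    (hxz : ∑ j, x j * z j = 0) (s θ : ℝ) :
    ∫⁻ g, ENNReal.ofReal (Real.exp (s *
      (F (mulVec g (Real.cos θ • x + Real.sin θ • z)) - F (mulVec g x)))) ∂(gaussMatrix n k) ≤
      ENNReal.ofReal (Real.exp (s ^ 2 * θ ^ 2 * Λ ^ 2 / 2)) := by
  have hFc := hF.continuous hΛ
  have hlim := tendsto_lintegral_rotation hΛ hF s θ
  refine (ge_of_tendsto hlim ?_).trans ?_
  · filter_upwards [Filter.eventually_gt_atTop 0] with N hN
    have hN' : (N : ℝ) ≠ 0 := by positivity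
    set u : ℕ → Fin k → ℝ := fun m => Real.cos (m * (θ / N)) • x + Real.sin (m * (θ / N)) • z
      with hu
    set w : ℕ → Fin k → ℝ := fun m => (-Real.sin (m * (θ / N))) • x + Real.cos (m * (θ / N)) • z
      with hw
    have hcomb : ∀ a b c d : ℝ, ∑ j, (a • x + b • z) j * (c • x + d • z) j = a * c + b * d := by
      intro a b c d
      calc _ = a * c * ∑ j, x j ^ 2 + b * d * ∑ j, z j ^ 2 + (a * d + b * c) * ∑ j, x j * z j := by
            simp only [Finset.mul_sum, ← Finset.sum_add_distrib]
            refine Finset.sum_congr rfl fun j _ => ?_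
            simp only [Pi.add_apply, Pi.smul_apply, smul_eq_mul]
            ring
        _ = _ := by rw [hx, hz, hxz]; ring
    have hu1 : ∀ m, ∑ j, u m j ^ 2 = 1 := fun m => by
      simp only [sq, hu, hcomb]
      have := Real.cos_sq_add_sin_sq (m * (θ / N))
      linarith
    have hw1 : ∀ m, ∑ j, w m j ^ 2 = 1 := fun m => by
      simp only [sq, hw, hcomb]
      have := Real.cos_sq_add_sin_sq (m * (θ / N))
      linarith
    have huw : ∀ m, ∑ j, u m j * w m j = 0 := fun m => by
      simp only [hu, hw, hcomb]
      ring
    have hstep : ∀ m, u (m + 1) = Real.cos (θ / N) • u m + Real.sin (θ / N) • w m := by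
      intro m
      simp only [hu, hw]
      push_cast
      rw [add_mul, one_mul, Real.cos_add, Real.sin_add]
      module
    set d : ℕ → (Fin n → Fin k → ℝ) → ℝ := fun m g =>
      s * (F (mulVec g (u (m + 1))) - F (mulVec g (u m))) with hd
    have hsum : ∀ g, s * (F (mulVec g (Real.cos θ • x + Real.sin θ • z)) - F (mulVec g x)) =
        ∑ m ∈ Finset.range N, d m g := by
      intro g
      rw [← Finset.mul_sum, Finset.sum_range_sub fun m => F (mulVec g (u m))]
      simp only [hu, mul_div_cancel₀ _ hN']
      simp
    have hdm : ∀ m, Measurable fun g => ENNReal.ofReal (Real.exp (N * d m g)) := by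
      intro m
      have h1 := hFc.comp (continuous_mulVec_left (n := n) (u (m + 1)))
      have h2 := hFc.comp (continuous_mulVec_left (n := n) (u m))
      refine (ENNReal.continuous_ofReal.comp (Real.continuous_exp.comp ?_)).measurable
      exact continuous_const.mul (continuous_const.mul (h1.sub h2))
    have hI : ∀ m, ∫⁻ g, ENNReal.ofReal (Real.exp (N * d m g)) ∂(gaussMatrix n k) =
        ∫⁻ P, ENNReal.ofReal (Real.exp (N * (s *
        (F (Real.cos (θ / N) • P.1 + Real.sin (θ / N) • P.2) - F P.1))))
        ∂((_root_.stdGaussian n).prod (_root_.stdGaussian n)) := by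
      intro m
      rw [← (measurePreserving_mulVec_pair n (u m) (w m) (hu1 m) (hw1 m) (huw m)).lintegral_comp]
      · simp only [hd, hstep, mulVec_add_smul]
      · refine (ENNReal.continuous_ofReal.comp ?_).measurable
        fun_prop
    calc _ ≤ ∫⁻ g, ∑ m ∈ Finset.range N, ENNReal.ofReal (N : ℝ)⁻¹ *
          ENNReal.ofReal (Real.exp (N * d m g)) ∂(gaussMatrix n k) := by
          refine lintegral_mono fun g => ?_
          rw [hsum]
          refine (ENNReal.ofReal_le_ofReal (exp_sum_le_average hN fun m => d m g)).trans ?_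
          rw [ENNReal.ofReal_sum_of_nonneg fun _ _ => by positivity]
          refine Finset.sum_le_sum fun m _ => ?_
          rw [ENNReal.ofReal_mul (by positivity)]
      _ = _ := by
          rw [lintegral_finsetSum _ fun m _ => (hdm m).const_mul _]
          simp only [lintegral_const_mul _ (hdm _), hI]
          rw [Finset.sum_const, Finset.card_range, nsmul_eq_mul, ← mul_assoc,
            ENNReal.ofReal_inv_of_pos (by positivity), ENNReal.ofReal_natCast,
            ENNReal.mul_inv_cancel (by positivity) (ENNReal.natCast_ne_top N), one_mul]
  · refine (lintegral_exp_fderiv_le hΛ hF (s * θ)).trans_eq ?_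
    rw [mul_pow]

lemma measure_ge_le_of_lintegral_exp_le {α : Type*} [MeasurableSpace α] {μ : Measure α}
    {X : α → ℝ} (hX : Measurable X) {D : ℝ} (hD : 0 < D)
    (h : ∀ s : ℝ, ∫⁻ a, ENNReal.ofReal (Real.exp (s * X a)) ∂μ ≤
      ENNReal.ofReal (Real.exp (s ^ 2 * D / 2))) {t : ℝ} (ht : 0 ≤ t) :
    μ {a | t ≤ X a} ≤ ENNReal.ofReal (Real.exp (-t ^ 2 / (2 * D))) := by
  set s := t / D with hs
  have hs0 : 0 ≤ s := by positivity
  have h1 : μ {a | t ≤ X a} ≤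
      μ {a | ENNReal.ofReal (Real.exp (s * t)) ≤ ENNReal.ofReal (Real.exp (s * X a))} :=
    measure_mono fun a (ha : t ≤ X a) =>
      ENNReal.ofReal_le_ofReal (Real.exp_le_exp.2 (mul_le_mul_of_nonneg_left ha hs0))
  refine h1.trans ((meas_ge_le_lintegral_div (by fun_prop) (by positivity) (by simp)).trans ?_)
  refine (ENNReal.div_le_div_right (h s) _).trans ?_
  rw [← ENNReal.ofReal_div_of_pos (Real.exp_pos _), ← Real.exp_sub]
  refine ENNReal.ofReal_le_ofReal (Real.exp_le_exp.2 (le_of_eq ?_))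
  rw [hs]
  field_simp
  ring

lemma measurable_increment {n k : ℕ} {F : (Fin n → ℝ) → ℝ} (hF : Continuous F)
    (x y : Fin k → ℝ) : Measurable fun g => F (mulVec g y) - F (mulVec g x) :=
  ((hF.comp (continuous_mulVec_left y)).sub (hF.comp (continuous_mulVec_left x))).measurable

lemma gaussMatrix_increment_ge_le {n k : ℕ} {Λ : ℝ} (hΛ : 0 < Λ) {F : (Fin n → ℝ) → ℝ}
    (hF : EucLip Λ F) {x y : Fin k → ℝ} (hx : eucNorm x = 1) (hy : eucNorm y = 1)
    {δ : ℝ} (hδ : 0 < δ) (hδ1 : δ ≤ 1) (hxy : eucNorm (x - y) ≤ δ) {t : ℝ} (ht : 0 ≤ t) :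
    gaussMatrix n k {g | t ≤ F (mulVec g y) - F (mulVec g x)} ≤
      ENNReal.ofReal (Real.exp (-t ^ 2 / (5 * Λ ^ 2 * δ ^ 2))) := by
  have hx2 : ∑ j, x j ^ 2 = 1 := by rw [← eucNorm_sq, hx, one_pow]
  have hy2 : ∑ j, y j ^ 2 = 1 := by rw [← eucNorm_sq, hy, one_pow]
  set c := ∑ j, x j * y j with hc
  have hsub : ∑ j, (x - y) j ^ 2 = 2 - 2 * c := by
    calc _ = ∑ j, x j ^ 2 + ∑ j, y j ^ 2 - 2 * c := by
          rw [hc, Finset.mul_sum, ← Finset.sum_add_distrib, ← Finset.sum_sub_distrib]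
          refine Finset.sum_congr rfl fun j _ => ?_
          simp only [Pi.sub_apply]
          ring
      _ = _ := by rw [hx2, hy2]; ring
  have hle : 2 - 2 * c ≤ δ ^ 2 := by
    rw [← hsub, ← eucNorm_sq]
    exact pow_le_pow_left₀ (eucNorm_nonneg _) hxy 2
  have hc1 : c ≤ 1 := by
    have : 0 ≤ ∑ j, (x - y) j ^ 2 := Finset.sum_nonneg fun _ _ => sq_nonneg _
    linarith
  have hc0 : 1 / 2 ≤ c := by nlinarith
  rw [show 5 * Λ ^ 2 * δ ^ 2 = 2 * (5 / 2 * Λ ^ 2 * δ ^ 2) by ring]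
  refine measure_ge_le_of_lintegral_exp_le (measurable_increment (hF.continuous hΛ.le) x y)
    (by positivity) (fun s => ?_) ht
  rcases hc1.eq_or_lt with hc1 | hc1
  · have : x = y := by
      have h0 : ∑ j, (x - y) j ^ 2 = 0 := by rw [hsub, hc1]; norm_num
      rw [Finset.sum_eq_zero_iff_of_nonneg fun _ _ => sq_nonneg _] at h0
      ext j
      have := h0 j (Finset.mem_univ j)
      simpa [sub_eq_zero] using this
    subst this
    simp only [sub_self, mul_zero, lintegral_const, measure_univ, mul_one]
    refine ENNReal.ofReal_le_ofReal (Real.exp_le_exp.2 (by positivity))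
  · set θ := Real.arccos c with hθ
    have hcos : Real.cos θ = c := Real.cos_arccos (by linarith) hc1.le
    have hsin : 0 < Real.sin θ := by
      rw [hθ, Real.sin_arccos]
      exact Real.sqrt_pos.2 (by nlinarith)
    have hsc := Real.cos_sq_add_sin_sq θ
    rw [hcos] at hsc
    set z : Fin k → ℝ := (Real.sin θ)⁻¹ • (y - c • x) with hz
    have hz2 : ∑ j, z j ^ 2 = 1 := by
      have h1 : ∑ j, (y - c • x) j ^ 2 = Real.sin θ ^ 2 := by
        have h : ∀ b : ℝ, ∑ j, (y - b • x) j ^ 2 =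
            ∑ j, y j ^ 2 - 2 * b * c + b ^ 2 * ∑ j, x j ^ 2 := by
          intro b
          rw [hc]
          simp only [Finset.mul_sum, ← Finset.sum_add_distrib, ← Finset.sum_sub_distrib]
          refine Finset.sum_congr rfl fun j _ => ?_
          simp only [Pi.sub_apply, Pi.smul_apply, smul_eq_mul]
          ring
        rw [h, hx2, hy2]
        linarith
      simp only [hz, Pi.smul_apply (Real.sin θ)⁻¹, smul_eq_mul, mul_pow]
      rw [← Finset.mul_sum, h1, ← mul_pow, inv_mul_cancel₀ hsin.ne', one_pow]
    have hxz : ∑ j, x j * z j = 0 := by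
      have h1 : ∑ j, x j * z j = (Real.sin θ)⁻¹ * (c - c * ∑ j, x j ^ 2) := by
        conv_rhs => enter [2, 1]; rw [hc]
        simp only [Finset.mul_sum, ← Finset.sum_sub_distrib]
        refine Finset.sum_congr rfl fun j _ => ?_
        simp only [hz, Pi.sub_apply, Pi.smul_apply, smul_eq_mul]
        ring
      rw [h1, hx2]
      ring
    have hyx : y = Real.cos θ • x + Real.sin θ • z := by
      rw [hz, smul_smul, mul_inv_cancel₀ hsin.ne', hcos]
      module
    have hmain := lintegral_exp_rotation_le hΛ.le hF x z hx2 hz2 hxz s θ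
    rw [← hyx] at hmain
    refine hmain.trans (ENNReal.ofReal_le_ofReal (Real.exp_le_exp.2 ?_))
    have hθ0 : 0 ≤ θ := Real.arccos_nonneg c
    have hθπ : θ ≤ Real.pi := Real.arccos_le_pi c
    have h1 : 2 / Real.pi * (θ / 2) ≤ Real.sin (θ / 2) :=
      Real.mul_le_sin (by linarith) (by linarith)
    have h2 : Real.sin (θ / 2) ^ 2 = (1 - c) / 2 := by
      have h := Real.cos_sq (θ / 2)
      rw [show 2 * (θ / 2) = θ by ring, hcos] at h
      have := Real.cos_sq_add_sin_sq (θ / 2)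
      linarith
    have h3 : (2 / Real.pi * (θ / 2)) ^ 2 ≤ (1 - c) / 2 := by
      rw [← h2]
      exact pow_le_pow_left₀ (by have := Real.pi_pos; positivity) h1 2
    have hπ := Real.pi_pos
    have h4 : θ ^ 2 ≤ Real.pi ^ 2 * ((1 - c) / 2) := by
      have : (2 / Real.pi * (θ / 2)) ^ 2 = θ ^ 2 / Real.pi ^ 2 := by field_simp
      rw [this, div_le_iff₀ (by positivity)] at h3
      linarith
    have h5 : Real.pi ^ 2 ≤ 10 := by
      have := Real.pi_lt_d2
      nlinarith
    have h6 : θ ^ 2 ≤ 5 / 2 * δ ^ 2 := by nlinarith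
    calc s ^ 2 * θ ^ 2 * Λ ^ 2 / 2 ≤ s ^ 2 * (5 / 2 * δ ^ 2) * Λ ^ 2 / 2 := by gcongr
      _ = _ := by ring

lemma stdGaussian_ge_add_le {n : ℕ} {Λ : ℝ} (hΛ : 0 < Λ) {F : (Fin n → ℝ) → ℝ}
    (hF : EucLip Λ F) {a t : ℝ} (ha : 1 / 4 ≤ _root_.stdGaussian n {x | F x ≤ a}) (ht : 0 ≤ t) :
    _root_.stdGaussian n {x | a + t ≤ F x} ≤
      4 * ENNReal.ofReal (Real.exp (-t ^ 2 / (5 * Λ ^ 2))) := by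
  have hFc := hF.continuous hΛ.le
  set x : Fin 2 → ℝ := ![1, 0]
  set z : Fin 2 → ℝ := ![0, 1]
  have hx : ∑ j, x j ^ 2 = 1 := by simp [x]
  have hz : ∑ j, z j ^ 2 = 1 := by simp [z]
  have hxz : ∑ j, x j * z j = 0 := by simp [x, z]
  have h1 : gaussMatrix n 2 {g | t ≤ F (mulVec g z) - F (mulVec g x)} ≤
      ENNReal.ofReal (Real.exp (-t ^ 2 / (2 * (5 / 2 * Λ ^ 2)))) := by
    refine measure_ge_le_of_lintegral_exp_le (measurable_increment hFc x z)
      (by positivity) (fun s => ?_) ht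
    have hmain := lintegral_exp_rotation_le hΛ.le hF x z hx hz hxz s (Real.pi / 2)
    simp only [Real.cos_pi_div_two, Real.sin_pi_div_two, zero_smul, one_smul, zero_add] at hmain
    refine hmain.trans (ENNReal.ofReal_le_ofReal (Real.exp_le_exp.2 ?_))
    have h5 : (Real.pi / 2) ^ 2 ≤ 5 / 2 := by
      have := Real.pi_lt_d2
      have := Real.pi_pos
      nlinarith
    calc s ^ 2 * (Real.pi / 2) ^ 2 * Λ ^ 2 / 2 ≤ s ^ 2 * (5 / 2) * Λ ^ 2 / 2 := by gcongr
      _ = _ := by ring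
  have h2 : _root_.stdGaussian n {x | F x ≤ a} * _root_.stdGaussian n {x | a + t ≤ F x} ≤
      gaussMatrix n 2 {g | t ≤ F (mulVec g z) - F (mulVec g x)} := by
    have hm1 : MeasurableSet {x | F x ≤ a} := measurableSet_le hFc.measurable measurable_const
    have hm2 : MeasurableSet {x | a + t ≤ F x} := measurableSet_le measurable_const hFc.measurable
    rw [← Measure.prod_prod, ← (measurePreserving_mulVec_pair n x z hx hz hxz).measure_preimage
      (hm1.prod hm2).nullMeasurableSet]
    refine measure_mono fun g hg => ?_
    have h1 : F (mulVec g x) ≤ a := hg.1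
    have h2 : a + t ≤ F (mulVec g z) := hg.2
    change t ≤ _
    linarith
  have h3 : 1 / 4 * _root_.stdGaussian n {x | a + t ≤ F x} ≤
      ENNReal.ofReal (Real.exp (-t ^ 2 / (5 * Λ ^ 2))) := by
    rw [show 5 * Λ ^ 2 = 2 * (5 / 2 * Λ ^ 2) by ring]
    exact (mul_le_mul_left ha _).trans (h2.trans h1)
  calc _ = 4 * (1 / 4 * _root_.stdGaussian n {x | a + t ≤ F x}) := by
        rw [← mul_assoc, one_div, ENNReal.mul_inv_cancel (by simp) (by simp), one_mul]
    _ ≤ _ := by gcongr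

lemma card_le_of_separated_sphere {E : Type*} [NormedAddCommGroup E] [NormedSpace ℝ E]
    [FiniteDimensional ℝ E] (s : Finset E) {ρ : ℝ} (hρ : 0 < ρ) (hs : ∀ c ∈ s, ‖c‖ = 1)
    (h : ∀ c ∈ s, ∀ d ∈ s, c ≠ d → 2 * ρ ≤ ‖c - d‖) :
    (s.card : ℝ) ≤ ((1 + ρ) / ρ) ^ Module.finrank ℝ E := by
  borelize E
  set μ : Measure E := Measure.addHaar
  have hD : Set.Pairwise (s : Set E)
      (Function.onFun Disjoint fun c => Metric.ball (c : E) ρ) := by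
    rintro c hc d hd hcd
    apply Metric.ball_disjoint_ball
    rw [dist_eq_norm]
    linarith [h c hc d hd hcd]
  have hsub : ⋃ c ∈ s, Metric.ball (c : E) ρ ⊆ Metric.ball (0 : E) (1 + ρ) := by
    refine Set.iUnion₂_subset fun x hx => Metric.ball_subset_ball' ?_
    rw [dist_zero_right, hs x hx, add_comm]
  have hI : (s.card : ENNReal) * ENNReal.ofReal (ρ ^ Module.finrank ℝ E) * μ (Metric.ball 0 1) ≤
      ENNReal.ofReal ((1 + ρ) ^ Module.finrank ℝ E) * μ (Metric.ball 0 1) := by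
    calc _ = μ (⋃ c ∈ s, Metric.ball (c : E) ρ) := by
          rw [measure_biUnion_finset hD fun c _ => measurableSet_ball]
          simp only [μ.addHaar_ball_of_pos _ hρ]
          simp only [Finset.sum_const, nsmul_eq_mul, mul_assoc]
      _ ≤ μ (Metric.ball (0 : E) (1 + ρ)) := measure_mono hsub
      _ = _ := μ.addHaar_ball_of_pos _ (by linarith)
  have hJ : (s.card : ENNReal) * ENNReal.ofReal (ρ ^ Module.finrank ℝ E) ≤
      ENNReal.ofReal ((1 + ρ) ^ Module.finrank ℝ E) :=
    (ENNReal.mul_le_mul_iff_left (Metric.measure_ball_pos _ _ zero_lt_one).ne'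
      measure_ball_lt_top.ne).1 hI
  have hK := ENNReal.toReal_le_of_le_ofReal (by positivity) hJ
  rw [ENNReal.toReal_mul, ENNReal.toReal_natCast, ENNReal.toReal_ofReal (by positivity)] at hK
  rwa [div_pow, le_div_iff₀ (by positivity)]

lemma exists_sphere_net (k j : ℕ) : ∃ s : Finset (Fin k → ℝ), (∀ x ∈ s, eucNorm x = 1) ∧
    (s.card : ℝ) ≤ (5 * 2 ^ j) ^ k ∧
    ∀ x : Fin k → ℝ, eucNorm x = 1 → ∃ y ∈ s, eucNorm (x - y) ≤ (1 / 2) ^ (j + 1) := by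
  classical
  set ρ : ℝ := (1 / 2) ^ (j + 2) with hρ
  have hρ0 : 0 < ρ := by positivity
  have h2ρ : 2 * ρ = (1 / 2) ^ (j + 1) := by rw [hρ, pow_succ _ (j + 1)]; ring
  set P : Finset (EuclideanSpace ℝ (Fin k)) → Prop := fun s => (∀ c ∈ s, ‖c‖ = 1) ∧
    ∀ c ∈ s, ∀ d ∈ s, c ≠ d → 2 * ρ ≤ ‖c - d‖ with hP
  have hbound : ∀ s, P s → (s.card : ℝ) ≤ (5 * 2 ^ j) ^ k := by
    intro s hs
    refine (card_le_of_separated_sphere s hρ0 hs.1 hs.2).trans ?_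
    rw [finrank_euclideanSpace_fin]
    refine pow_le_pow_left₀ (by positivity) ?_ k
    have h1 : ρ * 2 ^ (j + 2) = 1 := by
      rw [hρ, ← mul_pow]; norm_num
    have h2 : (1 : ℝ) ≤ 2 ^ j := one_le_pow₀ (by norm_num)
    rw [div_le_iff₀ hρ0]
    have h3 : ρ * 2 ^ j = 1 / 4 := by
      rw [pow_add] at h1
      linarith
    nlinarith
  set S : Set ℕ := {m | ∃ s, P s ∧ s.card = m}
  have hne : S.Nonempty := ⟨0, ∅, ⟨by simp, by simp⟩, by simp⟩
  have hbdd : BddAbove S := by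
    refine ⟨⌊((5 * 2 ^ j) ^ k : ℝ)⌋₊, ?_⟩
    rintro m ⟨s, hs, rfl⟩
    exact Nat.le_floor (hbound s hs)
  obtain ⟨s, hs, hcard⟩ := Nat.sSup_mem hne hbdd
  refine ⟨s.image WithLp.ofLp, ?_, ?_, ?_⟩
  · intro x hx
    obtain ⟨c, hc, rfl⟩ := Finset.mem_image.1 hx
    rw [eucNorm_eq_norm, WithLp.toLp_ofLp]
    exact hs.1 c hc
  · exact le_trans (by exact_mod_cast Finset.card_image_le) (hbound s hs)
  · intro x hx
    rw [eucNorm_eq_norm] at hx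
    by_contra! hcon
    have hfar : ∀ c ∈ s, 2 * ρ < ‖WithLp.toLp 2 x - c‖ := by
      intro c hc
      rw [h2ρ]
      have := hcon _ (Finset.mem_image_of_mem _ hc)
      rwa [eucNorm_eq_norm, WithLp.toLp_sub, WithLp.toLp_ofLp] at this
    have hnot : WithLp.toLp 2 x ∉ s := fun hmem => by
      have := hfar _ hmem
      rw [sub_self, norm_zero] at this
      linarith
    have hP' : P (insert (WithLp.toLp 2 x) s) := by
      refine ⟨fun c hc => ?_, fun c hc d hd hcd => ?_⟩
      · rcases Finset.mem_insert.1 hc with rfl | hc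
        · exact hx
        · exact hs.1 c hc
      · rcases Finset.mem_insert.1 hc with rfl | hc <;> rcases Finset.mem_insert.1 hd with rfl | hd
        · exact absurd rfl hcd
        · exact (hfar d hd).le
        · rw [norm_sub_rev]; exact (hfar c hc).le
        · exact hs.2 c hc d hd hcd
    have := le_csSup hbdd ⟨_, hP', rfl⟩
    rw [Finset.card_insert_of_notMem hnot, ← hcard] at this
    omega

lemma sum_range_succ_mul_half_pow_le (J : ℕ) :
    ∑ j ∈ Finset.range J, ((j : ℝ) + 1) * (1 / 2) ^ j ≤ 4 := by
  have h : ∑ j ∈ Finset.range J, ((j : ℝ) + 1) * (1 / 2) ^ j = 4 - 2 * (J + 2) * (1 / 2) ^ J := by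
    induction J with
    | zero => norm_num
    | succ J ih =>
      rw [Finset.sum_range_succ, ih, pow_succ]
      push_cast
      ring
  rw [h]
  have : 0 ≤ 2 * ((J : ℝ) + 2) * (1 / 2) ^ J := by positivity
  linarith

lemma chaining_bound_le {m : ℝ} (hm : 1 ≤ m) {k : ℕ} (hk : (k : ℝ) ≤ m) (j : ℕ) :
    (5 * 2 ^ j) ^ k * (5 * 2 ^ (j + 1)) ^ k * Real.exp (-(5 * (j + 1) ^ 2 * m)) ≤
      Real.exp (-m) * (1 / 2) ^ j := by
  have he : (2.7 : ℝ) ≤ Real.exp 1 := by linarith [Real.exp_one_gt_d9]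
  have h1 : (5 * 2 ^ j) * (5 * 2 ^ (j + 1)) ≤ Real.exp (4 + 2 * j) := by
    have e4 : (50 : ℝ) ≤ Real.exp 4 := by
      rw [show (4 : ℝ) = (4 : ℕ) * 1 by norm_num, Real.exp_nat_mul]
      calc (50 : ℝ) ≤ 2.7 ^ 4 := by norm_num
        _ ≤ _ := by gcongr
    have e2 : (4 : ℝ) ≤ Real.exp 2 := by
      rw [show (2 : ℝ) = (2 : ℕ) * 1 by norm_num, Real.exp_nat_mul]
      calc (4 : ℝ) ≤ 2.7 ^ 2 := by norm_num
        _ ≤ _ := by gcongr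
    rw [Real.exp_add, mul_comm (2 : ℝ) (j : ℝ), Real.exp_nat_mul]
    calc (5 * 2 ^ j : ℝ) * (5 * 2 ^ (j + 1)) = 50 * 4 ^ j := by
          rw [show (4 : ℝ) = 2 * 2 by norm_num, mul_pow, pow_succ]; ring
      _ ≤ _ := by gcongr
  have h2 : (5 * 2 ^ j : ℝ) ^ k * (5 * 2 ^ (j + 1)) ^ k ≤ Real.exp (m * (4 + 2 * j)) := by
    rw [← mul_pow]
    calc _ ≤ Real.exp (4 + 2 * j) ^ k := by gcongr
      _ = Real.exp (k * (4 + 2 * j)) := (Real.exp_nat_mul _ _).symm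
      _ ≤ _ := Real.exp_le_exp.2 (by gcongr)
  have h3 : (Real.exp (-1)) ^ j ≤ (1 / 2) ^ j := by
    refine pow_le_pow_left₀ (Real.exp_pos _).le ?_ j
    rw [Real.exp_neg, one_div]
    exact inv_anti₀ (by norm_num) (by linarith)
  calc _ ≤ Real.exp (m * (4 + 2 * j)) * Real.exp (-(5 * (j + 1) ^ 2 * m)) := by gcongr
    _ = Real.exp (m * (4 + 2 * j) - 5 * (j + 1) ^ 2 * m) := by rw [← Real.exp_add]; rfl
    _ ≤ Real.exp (-m + j * (-1)) := by
        refine Real.exp_le_exp.2 ?_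
        have hj : (0 : ℝ) ≤ j := Nat.cast_nonneg j
        nlinarith [mul_nonneg hj (by linarith : (0 : ℝ) ≤ m), mul_nonneg hj (sub_nonneg.2 hm),
          mul_nonneg (mul_nonneg hj hj) (by linarith : (0 : ℝ) ≤ m)]
    _ = Real.exp (-m) * Real.exp (-1) ^ j := by rw [Real.exp_add, ← Real.exp_nat_mul]
    _ ≤ _ := by gcongr

lemma chaining_base_le {m : ℝ} (hm : 1 ≤ m) {k : ℕ} (hk : (k : ℝ) ≤ m) :
    5 ^ k * Real.exp (-(5 * m)) ≤ Real.exp (-m) := by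
  have h5 : (5 : ℝ) ≤ Real.exp 2 := by
    have he : (2.7 : ℝ) ≤ Real.exp 1 := by linarith [Real.exp_one_gt_d9]
    rw [show (2 : ℝ) = (2 : ℕ) * 1 by norm_num, Real.exp_nat_mul]
    calc (5 : ℝ) ≤ 2.7 ^ 2 := by norm_num
      _ ≤ _ := by gcongr
  calc _ ≤ Real.exp 2 ^ k * Real.exp (-(5 * m)) := by gcongr
    _ = Real.exp (k * 2 - 5 * m) := by rw [← Real.exp_nat_mul, ← Real.exp_add]; rfl
    _ ≤ _ := Real.exp_le_exp.2 (by linarith)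

lemma gaussMatrix_exists_gt_le {n k : ℕ} {Λ : ℝ} (hΛ : 0 < Λ) {F : (Fin n → ℝ) → ℝ}
    (hF : EucLip Λ F) {a : ℝ} (ha : 1 / 4 ≤ _root_.stdGaussian n {x | F x ≤ a})
    {m : ℝ} (hm : 1 ≤ m) (hk : (k : ℝ) ≤ m) :
    gaussMatrix n k {g | ∃ x, eucNorm x = 1 ∧ a + 25 * Λ * Real.sqrt m < F (mulVec g x)} ≤
      6 * ENNReal.ofReal (Real.exp (-m)) := by
  have hFc := hF.continuous hΛ.le
  have hm0 : 0 ≤ m := by linarith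
  choose S hS1 hScard hScov using fun j => exists_sphere_net k j
  set t : ℕ → ℝ := fun j => 5 * Λ * Real.sqrt m * (((j : ℝ) + 1) * (1 / 2) ^ j) with ht
  set A : ℕ → Set (Fin n → Fin k → ℝ) := fun j => ⋃ u ∈ S j, ⋃ v ∈ S (j + 1),
    {g | eucNorm (u - v) ≤ (1 / 2) ^ j ∧ t j ≤ F (mulVec g v) - F (mulVec g u)} with hA
  set B : Set (Fin n → Fin k → ℝ) := ⋃ u ∈ S 0,
    {g | a + 5 * Λ * Real.sqrt m ≤ F (mulVec g u)} with hB
  have hsub : {g | ∃ x, eucNorm x = 1 ∧ a + 25 * Λ * Real.sqrt m < F (mulVec g x)} ⊆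
      B ∪ ⋃ j, A j := by
    rintro g ⟨x, hx, hgx⟩
    by_contra hcon
    simp only [hA, hB, Set.mem_union, Set.mem_iUnion, Set.mem_ofPred_eq, not_or, not_exists,
      not_and, not_le] at hcon
    obtain ⟨hcB, hcA⟩ := hcon
    choose y hyS hyx using fun j => hScov j x hx
    have hstep : ∀ J : ℕ, F (mulVec g (y J)) ≤
        a + 5 * Λ * Real.sqrt m + ∑ j ∈ Finset.range J, t j := by
      intro J
      induction J with
      | zero => simpa using (hcB (y 0) (hyS 0)).le
      | succ J ih =>
        have h1 := hcA J (y J) (hyS J) (y (J + 1)) (hyS (J + 1)) (by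
          have h2 : y J - y (J + 1) = (x - y (J + 1)) + (y J - x) := by abel
          have h3 := eucNorm_add_le (x - y (J + 1)) (y J - x)
          rw [← h2, eucNorm_sub_comm (y J) x] at h3
          have h4 := hyx J
          have h5 := hyx (J + 1)
          rw [pow_succ] at h4 h5
          rw [pow_succ] at h5
          have : (0 : ℝ) < (1 / 2) ^ J := by positivity
          linarith)
        rw [Finset.sum_range_succ]
        linarith
    have hall : ∀ J : ℕ, F (mulVec g (y J)) ≤ a + 25 * Λ * Real.sqrt m := by
      intro J
      refine (hstep J).trans ?_
      rw [← Finset.mul_sum]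
      have : 5 * Λ * Real.sqrt m * ∑ j ∈ Finset.range J, ((j : ℝ) + 1) * (1 / 2) ^ j ≤
          5 * Λ * Real.sqrt m * 4 := by
        gcongr
        exact sum_range_succ_mul_half_pow_le J
      linarith
    have hylim : Filter.Tendsto y Filter.atTop (nhds x) := by
      rw [tendsto_iff_dist_tendsto_zero]
      have h0 : Filter.Tendsto (fun j : ℕ => ((1 : ℝ) / 2) ^ (j + 1)) Filter.atTop (nhds 0) :=
        (tendsto_pow_atTop_nhds_zero_of_lt_one (by norm_num) (by norm_num)).comp
          (Filter.tendsto_add_atTop_nat 1)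
      refine squeeze_zero (fun _ => dist_nonneg) (fun j => ?_) h0
      refine le_trans ?_ (hyx j)
      rw [dist_comm, dist_eq_norm, pi_norm_le_iff_of_nonneg (eucNorm_nonneg _)]
      intro i
      rw [Real.norm_eq_abs]
      refine Real.abs_le_sqrt ?_
      exact Finset.single_le_sum (f := fun i => (x - y j) i ^ 2) (fun _ _ => sq_nonneg _)
        (Finset.mem_univ i)
    have hlim := ((hFc.comp (continuous_mulVec_right g)).tendsto x).comp hylim
    exact absurd (le_of_tendsto' hlim hall) (not_le.2 hgx)
  have hBle : gaussMatrix n k B ≤ 4 * ENNReal.ofReal (Real.exp (-m)) := by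
    have h1 : ∀ u ∈ S 0, gaussMatrix n k {g | a + 5 * Λ * Real.sqrt m ≤ F (mulVec g u)} ≤
        4 * ENNReal.ofReal (Real.exp (-(5 * m))) := by
      intro u hu
      have h := (measurePreserving_mulVec n u (by
        rw [← eucNorm_sq, hS1 0 u hu, one_pow])).measure_preimage
        (measurableSet_le (measurable_const (a := a + 5 * Λ * Real.sqrt m))
          hFc.measurable).nullMeasurableSet
      refine h.le.trans ((stdGaussian_ge_add_le hΛ hF ha (by positivity)).trans_eq ?_)
      congr 3
      rw [mul_pow, mul_pow, Real.sq_sqrt hm0]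
      field_simp
    calc gaussMatrix n k B ≤ ∑ u ∈ S 0,
          gaussMatrix n k {g | a + 5 * Λ * Real.sqrt m ≤ F (mulVec g u)} :=
          measure_biUnion_finset_le _ _
      _ ≤ (S 0).card * (4 * ENNReal.ofReal (Real.exp (-(5 * m)))) := by
          rw [← nsmul_eq_mul]
          exact Finset.sum_le_card_nsmul _ _ _ h1
      _ = 4 * ENNReal.ofReal ((S 0).card * Real.exp (-(5 * m))) := by
          rw [ENNReal.ofReal_mul (by positivity), ENNReal.ofReal_natCast]
          ring
      _ ≤ _ := by
          gcongr
          refine le_trans ?_ (chaining_base_le hm hk)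
          gcongr
          simpa using hScard 0
  have hAle : ∀ j, gaussMatrix n k (A j) ≤
      ENNReal.ofReal (Real.exp (-m)) * (2⁻¹ : ENNReal) ^ j := by
    intro j
    have h1 : ∀ u ∈ S j, ∀ v ∈ S (j + 1), gaussMatrix n k
        {g | eucNorm (u - v) ≤ (1 / 2) ^ j ∧ t j ≤ F (mulVec g v) - F (mulVec g u)} ≤
        ENNReal.ofReal (Real.exp (-(5 * (j + 1) ^ 2 * m))) := by
      intro u hu v hv
      by_cases huv : eucNorm (u - v) ≤ (1 / 2) ^ j
      · simp only [huv, true_and]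
        refine (gaussMatrix_increment_ge_le hΛ hF (hS1 j u hu) (hS1 (j + 1) v hv)
          (by positivity) (pow_le_one₀ (by norm_num) (by norm_num)) huv
          (by positivity)).trans_eq ?_
        congr 2
        rw [ht]
        simp only [mul_pow, Real.sq_sqrt hm0]
        field_simp
      · simp only [huv, false_and, Set.ofPred_false, measure_empty, zero_le]
    calc gaussMatrix n k (A j) ≤ ∑ u ∈ S j, gaussMatrix n k (⋃ v ∈ S (j + 1),
          {g | eucNorm (u - v) ≤ (1 / 2) ^ j ∧ t j ≤ F (mulVec g v) - F (mulVec g u)}) :=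
          measure_biUnion_finset_le _ _
      _ ≤ (S j).card * ((S (j + 1)).card * ENNReal.ofReal (Real.exp (-(5 * (j + 1) ^ 2 * m)))) := by
          rw [← nsmul_eq_mul, ← nsmul_eq_mul]
          refine Finset.sum_le_card_nsmul _ _ _ fun u hu => ?_
          refine (measure_biUnion_finset_le _ _).trans ?_
          exact Finset.sum_le_card_nsmul _ _ _ fun v hv => h1 u hu v hv
      _ = ENNReal.ofReal ((S j).card * (S (j + 1)).card *
            Real.exp (-(5 * (j + 1) ^ 2 * m))) := by
          rw [ENNReal.ofReal_mul (by positivity), ENNReal.ofReal_mul (by positivity),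
            ENNReal.ofReal_natCast, ENNReal.ofReal_natCast, ← mul_assoc]
      _ ≤ ENNReal.ofReal (Real.exp (-m) * (1 / 2) ^ j) := by
          refine ENNReal.ofReal_le_ofReal (le_trans ?_ (chaining_bound_le hm hk j))
          gcongr
          · exact hScard j
          · exact hScard (j + 1)
      _ = _ := by
          rw [ENNReal.ofReal_mul (Real.exp_pos _).le, ENNReal.ofReal_pow (by norm_num), one_div,
            ENNReal.ofReal_inv_of_pos (by norm_num)]
          norm_num
  calc _ ≤ gaussMatrix n k (B ∪ ⋃ j, A j) := measure_mono hsub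
    _ ≤ gaussMatrix n k B + gaussMatrix n k (⋃ j, A j) := measure_union_le _ _
    _ ≤ 4 * ENNReal.ofReal (Real.exp (-m)) +
        ∑' j, ENNReal.ofReal (Real.exp (-m)) * (2⁻¹ : ENNReal) ^ j := by
        gcongr
        exact (measure_iUnion_le _).trans (ENNReal.tsum_le_tsum hAle)
    _ = _ := by
        rw [ENNReal.tsum_mul_left, ENNReal.tsum_geometric, ENNReal.one_sub_inv_two, inv_inv]
        ring

lemma lintegral_exp_sq_gaussianReal_le :
    ∫⁻ v, ENNReal.ofReal (Real.exp (v ^ 2 / 4)) ∂(gaussianReal 0 1) ≤ 3 / 2 := by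
  rw [gaussianReal_of_var_ne_zero 0 one_ne_zero,
    lintegral_withDensity_eq_lintegral_mul _ (measurable_gaussianPDF 0 1) (by fun_prop)]
  have h1 : ∀ v : ℝ, (gaussianPDF 0 1 * fun v => ENNReal.ofReal (Real.exp (v ^ 2 / 4))) v =
      ENNReal.ofReal ((Real.sqrt (2 * Real.pi))⁻¹ * Real.exp (-(1 / 4) * v ^ 2)) := by
    intro v
    rw [Pi.mul_apply, gaussianPDF, ← ENNReal.ofReal_mul (gaussianPDFReal_nonneg 0 1 v),
      gaussianPDFReal, mul_assoc, ← Real.exp_add]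
    congr 3
    · simp
    · push_cast; ring_nf
  rw [lintegral_congr h1, ← ofReal_integral_eq_lintegral_ofReal
    ((integrable_exp_neg_mul_sq (by norm_num)).const_mul _)
    (Filter.Eventually.of_forall fun v => by positivity), integral_const_mul, integral_gaussian]
  have h2 : (Real.sqrt (2 * Real.pi))⁻¹ * Real.sqrt (Real.pi / (1 / 4)) ≤ 3 / 2 := by
    have hpi := Real.pi_pos
    rw [inv_mul_le_iff₀ (by positivity)]
    refine Real.sqrt_le_iff.2 ⟨by positivity, ?_⟩
    rw [mul_pow, Real.sq_sqrt (by positivity)]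
    linarith
  refine (ENNReal.ofReal_le_ofReal h2).trans_eq ?_
  rw [ENNReal.ofReal_div_of_pos (by norm_num)]
  norm_num

lemma lintegral_sum_exp_sq_le (n : ℕ) :
    ∫⁻ x, ENNReal.ofReal (∑ j, Real.exp (x j ^ 2 / 4)) ∂(_root_.stdGaussian n) ≤
      n * (3 / 2) := by
  have h : ∀ j : Fin n, ∫⁻ x, ENNReal.ofReal (Real.exp (x j ^ 2 / 4)) ∂(_root_.stdGaussian n) ≤
      3 / 2 := by
    intro j
    refine le_trans (le_of_eq ?_) lintegral_exp_sq_gaussianReal_le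
    exact (measurePreserving_eval (fun _ : Fin n => gaussianReal 0 1) j).lintegral_comp
      (f := fun v => ENNReal.ofReal (Real.exp (v ^ 2 / 4))) (by fun_prop)
  calc _ = ∑ j, ∫⁻ x, ENNReal.ofReal (Real.exp (x j ^ 2 / 4)) ∂(_root_.stdGaussian n) := by
        rw [← lintegral_finsetSum _ fun j _ => by fun_prop]
        refine lintegral_congr fun x => ?_
        rw [ENNReal.ofReal_sum_of_nonneg fun _ _ => (Real.exp_pos _).le]
    _ ≤ ∑ _j : Fin n, (3 / 2 : ENNReal) := Finset.sum_le_sum fun j _ => h j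
    _ = _ := by simp

/-- The weighted sum controlling the gradient of `lorSum r p` at a typical Gaussian point. -/
noncomputable def gradSum (n : ℕ) (r p : ℝ) : ℝ :=
  ∑ i : Fin n, ((i : ℝ) + 1) ^ (-(2 * r)) * (4 * Real.log (6 * n / ((i : ℝ) + 1))) ^ (p - 1)

lemma log_six_mul_div_nonneg {n : ℕ} (i : Fin n) : 0 ≤ Real.log (6 * n / ((i : ℝ) + 1)) := by
  refine Real.log_nonneg ?_
  have : (i : ℝ) + 1 ≤ n := by exact_mod_cast i.2
  rw [le_div_iff₀ (by positivity)]
  have : (0 : ℝ) ≤ i := by positivity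
  linarith

lemma gradSum_nonneg (n : ℕ) (r p : ℝ) : 0 ≤ gradSum n r p :=
  Finset.sum_nonneg fun i _ => mul_nonneg (weight_pos _ i).le
    (Real.rpow_nonneg (mul_nonneg (by norm_num) (log_six_mul_div_nonneg i)) _)

lemma stdGaussian_lorSum_le {n : ℕ} (hn : 1 ≤ n) {r p : ℝ} (hp : 1 ≤ p) :
    3 / 4 ≤ _root_.stdGaussian n {x | lorSum (2 * r) (2 * (p - 1)) x ≤ gradSum n r p} := by
  set A : Set (Fin n → ℝ) := {x | 6 * (n : ℝ) ≤ ∑ j, Real.exp (x j ^ 2 / 4)} with hA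
  have hn0 : (0 : ℝ) < n := by exact_mod_cast hn
  have hAm : MeasurableSet A := measurableSet_le measurable_const (by fun_prop)
  have hA1 : _root_.stdGaussian n A ≤ 1 / 4 := by
    have h1 : A ⊆ {x | ENNReal.ofReal (6 * n) ≤
        ENNReal.ofReal (∑ j, Real.exp (x j ^ 2 / 4))} := fun x hx => ENNReal.ofReal_le_ofReal hx
    refine (measure_mono h1).trans ((meas_ge_le_lintegral_div
      (Measurable.aemeasurable (by fun_prop)) (by positivity) ENNReal.ofReal_ne_top).trans ?_)
    refine (ENNReal.div_le_div_right (lintegral_sum_exp_sq_le n) _).trans_eq ?_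
    rw [ENNReal.ofReal_mul (by norm_num), ENNReal.ofReal_natCast, mul_comm (n : ENNReal),
      ENNReal.mul_div_mul_right _ _ (by positivity) (by simp), ← ENNReal.toReal_eq_toReal_iff'
      (by simp [ENNReal.div_eq_top]) (by simp)]
    norm_num
  have hsub : Aᶜ ⊆ {x | lorSum (2 * r) (2 * (p - 1)) x ≤ gradSum n r p} := by
    intro x hx
    have hx' : ∑ j, Real.exp (x j ^ 2 / 4) ≤ 6 * n :=
      (not_le.1 (show ¬ 6 * (n : ℝ) ≤ _ from hx)).le
    refine Finset.sum_le_sum fun i _ => mul_le_mul_of_nonneg_left ?_ (weight_pos _ i).le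
    rw [Real.rpow_mul (decRe_nonneg x i), Real.rpow_two]
    exact Real.rpow_le_rpow (sq_nonneg _) (decRe_sq_le x hx' i) (by linarith)
  refine le_trans ?_ (measure_mono hsub)
  rw [prob_compl_eq_one_sub hAm]
  calc (3 / 4 : ENNReal) = 1 - 1 / 4 := by
        rw [← ENNReal.toReal_eq_toReal_iff' (by simp [ENNReal.div_eq_top]) (by simp),
          ENNReal.toReal_sub_of_le (by simp) (by simp)]
        norm_num
    _ ≤ _ := tsub_le_tsub_left hA1 1

lemma exp_le_gaussianReal_tail {p : ℝ} (hp : 1 ≤ p) :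
    Real.exp (-(3 * p)) ≤ (gaussianReal 0 1).real {v | Real.sqrt p ≤ |v|} := by
  have hp0 : 0 ≤ Real.sqrt p := Real.sqrt_nonneg p
  have hsq : Real.sqrt p ^ 2 = p := Real.sq_sqrt (by linarith)
  have h1 : ENNReal.ofReal (Real.exp (-(3 * p))) ≤
      gaussianReal 0 1 (Set.Icc (Real.sqrt p) (Real.sqrt p + 1)) := by
    rw [gaussianReal_apply 0 one_ne_zero]
    calc ENNReal.ofReal (Real.exp (-(3 * p))) =
          ∫⁻ _ in Set.Icc (Real.sqrt p) (Real.sqrt p + 1),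
            ENNReal.ofReal (Real.exp (-(3 * p))) := by
          simp
      _ ≤ _ := by
          refine setLIntegral_mono' measurableSet_Icc fun v hv => ?_
          rw [gaussianPDF]
          refine ENNReal.ofReal_le_ofReal ?_
          rw [gaussianPDFReal]
          have hpi : Real.sqrt (2 * Real.pi * (1 : NNReal)) ≤ Real.exp 1 := by
            refine Real.sqrt_le_iff.2 ⟨(Real.exp_pos _).le, ?_⟩
            have he : (2.7 : ℝ) ≤ Real.exp 1 := by linarith [Real.exp_one_gt_d9]
            have := Real.pi_lt_d2
            push_cast
            nlinarith
          have hpi' : Real.exp (-1) ≤ (Real.sqrt (2 * Real.pi * (1 : NNReal)))⁻¹ := by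
            rw [Real.exp_neg]
            refine inv_anti₀ (Real.sqrt_pos.2 ?_) hpi
            have := Real.pi_pos
            push_cast
            linarith
          have hv2 : v ^ 2 ≤ 2 * p + 2 := by
            have h2 : v ^ 2 ≤ (Real.sqrt p + 1) ^ 2 :=
              pow_le_pow_left₀ (hp0.trans hv.1) hv.2 2
            nlinarith [sq_nonneg (Real.sqrt p - 1)]
          calc Real.exp (-(3 * p)) ≤ Real.exp (-1) * Real.exp (-(p + 1)) := by
                rw [← Real.exp_add]
                exact Real.exp_le_exp.2 (by linarith)
            _ ≤ _ := by
                refine mul_le_mul hpi' (Real.exp_le_exp.2 ?_) (Real.exp_pos _).le (by positivity)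
                push_cast
                linarith
  have h2 : Set.Icc (Real.sqrt p) (Real.sqrt p + 1) ⊆ {v | Real.sqrt p ≤ |v|} :=
    fun v hv => hv.1.trans (le_abs_self v)
  have h3 := h1.trans (measure_mono h2)
  exact (ENNReal.ofReal_le_iff_le_toReal (measure_ne_top _ _)).1 h3

/-- `e⁻¹` on `{|v| ≥ s}` and `1` elsewhere. -/
noncomputable def tailDamp (s v : ℝ) : ℝ := if s ≤ |v| then Real.exp (-1) else 1

lemma measurable_tailDamp (s : ℝ) : Measurable (tailDamp s) :=
  Measurable.ite (measurableSet_le measurable_const (by fun_prop)) measurable_const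
    measurable_const

lemma tailDamp_pos (s v : ℝ) : 0 < tailDamp s v := by
  unfold tailDamp; split_ifs <;> positivity

lemma tailDamp_le_one (s v : ℝ) : tailDamp s v ≤ 1 := by
  unfold tailDamp
  split_ifs
  · exact Real.exp_le_one_iff.2 (by norm_num)
  · exact le_rfl

lemma integrable_tailDamp (s : ℝ) : Integrable (tailDamp s) (gaussianReal 0 1) := by
  refine Integrable.mono' (integrable_const 1) (measurable_tailDamp s).aestronglyMeasurable
    (Filter.Eventually.of_forall fun v => ?_)
  rw [Real.norm_eq_abs, abs_of_pos (tailDamp_pos s v)]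
  exact tailDamp_le_one s v

lemma integral_tailDamp_le (s : ℝ) : ∫ v, tailDamp s v ∂(gaussianReal 0 1) ≤
    Real.exp (-((gaussianReal 0 1).real {v | s ≤ |v|} / 2)) := by
  have hm : MeasurableSet {v : ℝ | s ≤ |v|} := measurableSet_le measurable_const (by fun_prop)
  have h1 : ∀ v, tailDamp s v =
      1 - {v : ℝ | s ≤ |v|}.indicator (fun _ => 1 - Real.exp (-1)) v := by
    intro v
    unfold tailDamp
    by_cases h : s ≤ |v| <;> simp [Set.indicator, h]
  simp only [h1]
  rw [integral_sub (integrable_const 1) ((integrable_const _).indicator hm),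
    integral_indicator_const _ hm]
  have he : Real.exp (-1) ≤ 1 / 2 := by
    rw [Real.exp_neg, one_div]
    exact inv_anti₀ (by norm_num) (by linarith [Real.exp_one_gt_d9])
  have h2 : 0 ≤ (gaussianReal 0 1).real {v : ℝ | s ≤ |v|} := measureReal_nonneg
  have h3 := Real.add_one_le_exp (-((gaussianReal 0 1).real {v : ℝ | s ≤ |v|} / 2))
  simp only [integral_const, probReal_univ, smul_eq_mul, one_mul]
  nlinarith

lemma stdGaussian_sum_rpow_lt {n : ℕ} {p : ℝ} (hp : 3 / 2 ≤ p)
    (hn : 4 ≤ n * Real.exp (-(3 * p))) :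
    _root_.stdGaussian n {x | ∑ j, |x j| ^ p < n * Real.exp (-(4 * p)) * p ^ (p / 2)} < 1 / 2 := by
  set s := Real.sqrt p with hs
  set T := n * Real.exp (-(4 * p)) with hT
  set q := (gaussianReal 0 1).real {v | s ≤ |v|} with hq
  have hsp : s ^ p = p ^ (p / 2) := by
    rw [hs, Real.sqrt_eq_rpow, ← Real.rpow_mul (by linarith)]
    congr 1
    ring
  have hsp0 : 0 < s ^ p := Real.rpow_pos_of_pos (Real.sqrt_pos.2 (by linarith)) _
  have hq1 : Real.exp (-(3 * p)) ≤ q := exp_le_gaussianReal_tail (by linarith)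
  set g : (Fin n → ℝ) → ℝ := fun x => ∏ j, tailDamp s (x j) with hg
  have hgi : Integrable g (_root_.stdGaussian n) :=
    Integrable.fintype_prod (f := fun (_ : Fin n) (v : ℝ) => tailDamp s v)
      fun _ => integrable_tailDamp s
  have hsub : {x : Fin n → ℝ | ∑ j, |x j| ^ p < T * p ^ (p / 2)} ⊆
      {x | Real.exp (-T) ≤ g x} := by
    intro x hx
    have hx' : ∑ j, |x j| ^ p < T * s ^ p := by rw [hsp]; exact hx
    have h1 : ∀ j, Real.exp (-(|x j| ^ p / s ^ p)) ≤ tailDamp s (x j) := by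
      intro j
      unfold tailDamp
      split_ifs with h
      · refine Real.exp_le_exp.2 (neg_le_neg ?_)
        rw [le_div_iff₀ hsp0, one_mul]
        exact Real.rpow_le_rpow (Real.sqrt_nonneg p) h (by linarith)
      · exact Real.exp_le_one_iff.2 (by have := abs_nonneg (x j); simp; positivity)
    calc Real.exp (-T) ≤ Real.exp (∑ j, -(|x j| ^ p / s ^ p)) := by
          refine Real.exp_le_exp.2 ?_
          rw [Finset.sum_neg_distrib, ← Finset.sum_div]
          refine neg_le_neg ?_
          rw [div_le_iff₀ hsp0]
          exact hx'.le
      _ = ∏ j, Real.exp (-(|x j| ^ p / s ^ p)) := Real.exp_sum _ _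
      _ ≤ g x := Finset.prod_le_prod (fun _ _ => (Real.exp_pos _).le) fun j _ => h1 j
  have h_int : ∫ x, g x ∂(_root_.stdGaussian n) ≤ Real.exp (-(n * q / 2)) := by
    rw [hg, _root_.stdGaussian, integral_fintype_prod_eq_prod
      (f := fun (_ : Fin n) (v : ℝ) => tailDamp s v), Finset.prod_const, Finset.card_univ,
      Fintype.card_fin]
    calc _ ≤ Real.exp (-(q / 2)) ^ n := by
          refine pow_le_pow_left₀ (integral_nonneg fun v => (tailDamp_pos s v).le)
            (integral_tailDamp_le s) n
      _ = _ := by rw [← Real.exp_nat_mul]; congr 1; ring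
  have hmarkov := mul_meas_ge_le_integral_of_nonneg (μ := _root_.stdGaussian n)
    (Filter.Eventually.of_forall fun x => Finset.prod_nonneg fun j _ => (tailDamp_pos s (x j)).le)
    hgi (Real.exp (-T))
  have hTq : T ≤ n * q / 4 := by
    have h1 : Real.exp (-p) ≤ 1 / 4 := by
      have h2 : Real.exp (-p) ≤ Real.exp (-(3 / 2)) := Real.exp_le_exp.2 (by linarith)
      refine h2.trans ?_
      rw [Real.exp_neg, one_div]
      refine inv_anti₀ (by norm_num) ?_
      have h3 := Real.sum_le_exp_of_nonneg (x := 3 / 2) (by norm_num) 4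
      simp [Finset.sum_range_succ, Nat.factorial] at h3
      linarith
    calc T = n * (Real.exp (-(3 * p)) * Real.exp (-p)) := by
          rw [hT, ← Real.exp_add]; congr 2; ring
      _ ≤ n * (q * (1 / 4)) := by gcongr
      _ = _ := by ring
  have hnq : 4 ≤ n * q := hn.trans (by gcongr)
  have hfin : (_root_.stdGaussian n).real {x | Real.exp (-T) ≤ g x} ≤ Real.exp (-1) := by
    have h1 : (_root_.stdGaussian n).real {x | Real.exp (-T) ≤ g x} =
        Real.exp T * (Real.exp (-T) * (_root_.stdGaussian n).real {x | Real.exp (-T) ≤ g x}) := by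
      rw [← mul_assoc, ← Real.exp_add, add_neg_cancel, Real.exp_zero, one_mul]
    rw [h1]
    calc _ ≤ Real.exp T * Real.exp (-(n * q / 2)) := by
          gcongr
          exact hmarkov.trans h_int
      _ = Real.exp (T - n * q / 2) := by rw [← Real.exp_add]; rfl
      _ ≤ _ := Real.exp_le_exp.2 (by linarith)
  have he : Real.exp (-1) < 1 / 2 := by
    rw [Real.exp_neg, one_div]
    exact inv_strictAnti₀ (by norm_num) (by linarith [Real.exp_one_gt_d9])
  refine (measure_mono hsub).trans_lt ?_
  have h2 : _root_.stdGaussian n {x | Real.exp (-T) ≤ g x} < ENNReal.ofReal (1 / 2) :=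
    (ENNReal.lt_ofReal_iff_toReal_lt (measure_ne_top _ _)).2 (hfin.trans_lt he)
  rwa [ENNReal.ofReal_div_of_pos (by norm_num), ENNReal.ofReal_one, ENNReal.ofReal_ofNat] at h2

lemma IsMedian.le_rpow {n : ℕ} {r p M : ℝ} (hr : 0 ≤ r) (hp : 3 / 2 ≤ p)
    (hn : 4 ≤ n * Real.exp (-(3 * p))) (hM : IsMedian (_root_.stdGaussian n) (lorNorm r p) M) :
    0 ≤ M ∧ (n : ℝ) ^ (1 - r) * Real.exp (-(4 * p)) * p ^ (p / 2) ≤ M ^ p := by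
  have hn0 : 0 < (n : ℝ) := by
    by_contra hcon
    have := mul_nonpos_of_nonpos_of_nonneg (not_lt.1 hcon) (Real.exp_pos (-(3 * p))).le
    linarith
  have hM0 : 0 ≤ M := by
    by_contra hcon
    have h1 : {x : Fin n → ℝ | lorNorm r p x ≤ M} = ∅ := by
      ext x
      simp only [Set.mem_ofPred_eq, Set.mem_empty_iff_false, iff_false, not_le]
      exact (not_le.1 hcon).trans_le (lorNorm_nonneg r p x)
    have h2 := hM.2
    rw [h1, measure_empty] at h2
    simp at h2
  refine ⟨hM0, ?_⟩
  by_contra! hcon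
  refine absurd (hM.2.trans (measure_mono ?_)) (not_le.2 (stdGaussian_sum_rpow_lt hp hn))
  intro x hx
  have h1 : lorSum r p x ≤ M ^ p := by
    rw [← lorNorm_rpow x (by linarith : 0 < p)]
    exact Real.rpow_le_rpow (lorNorm_nonneg r p x) hx (by linarith)
  have h3 := ((lorSum_ge hr (by linarith : 0 ≤ p) x).trans h1).trans_lt hcon
  rw [sub_eq_add_neg, Real.rpow_add hn0, Real.rpow_one] at h3
  have h4 : 0 < (n : ℝ) ^ (-r) := by positivity
  change ∑ j, |x j| ^ p < _
  refine lt_of_mul_lt_mul_left ?_ h4.le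
  linarith

lemma lipPow_pos {n : ℕ} (hn : 1 ≤ n) (r p : ℝ) : 0 < lipPow n r p := by
  unfold lipPow
  have : Nonempty (Fin n) := ⟨⟨0, hn⟩⟩
  split_ifs <;> positivity

lemma sqrt_lorSum_eq {n : ℕ} {r p : ℝ} (hp : 1 < p) (x : Fin n → ℝ) :
    Real.sqrt (lorSum (2 * r) (2 * (p - 1)) x) = lorNorm (2 * r) (2 * (p - 1)) x ^ (p - 1) := by
  rw [← lorNorm_rpow x (by linarith : 0 < 2 * (p - 1)), mul_comm (2 : ℝ) (p - 1),
    Real.rpow_mul (lorNorm_nonneg _ _ x), Real.rpow_two,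
    Real.sqrt_sq (Real.rpow_nonneg (lorNorm_nonneg _ _ x) _)]

lemma exists_eucLip_eq_lorSum (n : ℕ) {r p R : ℝ} (hr : 0 ≤ r) (hp : 1 < p) (hR : 0 ≤ R) :
    ∃ F : (Fin n → ℝ) → ℝ, EucLip (p * R ^ (p - 1)) F ∧
      ∀ x, lorNorm (2 * r) (2 * (p - 1)) x ≤ R → F x = lorSum r p x := by
  have hΛ : 0 ≤ p * R ^ (p - 1) := by positivity
  set K : Set (EuclideanSpace ℝ (Fin n)) :=
    {x | lorNorm (2 * r) (2 * (p - 1)) x.ofLp ≤ R} with hK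
  have hlip : ∀ x ∈ K, ∀ y : EuclideanSpace ℝ (Fin n),
      lorSum r p x.ofLp - lorSum r p y.ofLp ≤ p * R ^ (p - 1) * eucNorm (x.ofLp - y.ofLp) := by
    intro x hx y
    refine (lorSum_sub_le hr hp.le x.ofLp y.ofLp).trans ?_
    rw [sqrt_lorSum_eq hp]
    have : lorNorm (2 * r) (2 * (p - 1)) x.ofLp ^ (p - 1) ≤ R ^ (p - 1) :=
      Real.rpow_le_rpow (lorNorm_nonneg _ _ _) hx (by linarith)
    have := eucNorm_nonneg (x.ofLp - y.ofLp)
    gcongr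
  have hon : LipschitzOnWith (Real.toNNReal (p * R ^ (p - 1)))
      (fun x : EuclideanSpace ℝ (Fin n) => lorSum r p x.ofLp) K := by
    refine LipschitzOnWith.of_dist_le_mul fun x hx y hy => ?_
    rw [Real.dist_eq, dist_eq_norm, Real.coe_toNNReal _ hΛ, abs_sub_le_iff]
    have h1 := hlip x hx y
    have h2 := hlip y hy x
    rw [eucNorm_sub_comm] at h2
    rw [eucNorm_eq_norm, WithLp.toLp_sub, WithLp.toLp_ofLp, WithLp.toLp_ofLp] at h1 h2
    exact ⟨h1, h2⟩
  obtain ⟨G, hG, hGK⟩ := hon.extend_real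
  refine ⟨fun x => G (WithLp.toLp 2 x), fun x y => ?_, fun x hx => ?_⟩
  · have h := hG.dist_le_mul (WithLp.toLp 2 x) (WithLp.toLp 2 y)
    rwa [Real.dist_eq, dist_eq_norm, Real.coe_toNNReal _ hΛ, ← WithLp.toLp_sub,
      ← eucNorm_eq_norm] at h
  · exact (hGK (show WithLp.toLp 2 x ∈ K from hx)).symm

lemma one_fourth_le_of_half_le {α : Type*} [MeasurableSpace α] {μ : Measure α}
    [IsProbabilityMeasure μ] {A B C : Set α} (hA : 1 / 2 ≤ μ A) (hB : 3 / 4 ≤ μ B)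
    (hBm : MeasurableSet B) (h : A ∩ B ⊆ C) : 1 / 4 ≤ μ C := by
  have h1 : μ A ≤ μ C + μ Bᶜ :=
    (measure_mono fun x hx => by
      by_cases hxB : x ∈ B
      · exact Or.inl (h ⟨hx, hxB⟩)
      · exact Or.inr hxB).trans (measure_union_le C Bᶜ)
  have h2 : μ Bᶜ ≤ 1 / 4 := by
    rw [prob_compl_eq_one_sub hBm]
    refine (tsub_le_tsub_left hB 1).trans_eq ?_
    rw [← ENNReal.toReal_eq_toReal_iff' (by simp) (by simp),
      ENNReal.toReal_sub_of_le _ (by simp)]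
    · norm_num
    · exact hB.trans prob_le_one
  have h3 : (1 / 4 : ENNReal) + 1 / 4 ≤ μ C + 1 / 4 := by
    refine le_trans (le_of_eq ?_) (hA.trans (h1.trans (add_le_add_right h2 _)))
    rw [← ENNReal.toReal_eq_toReal_iff' (by simp)
      (by simp),
      ENNReal.toReal_add (by simp) (by simp)]
    norm_num
  exact (ENNReal.add_le_add_iff_right (by simp)).1 h3

lemma lorNorm_mulVec_bounds {n k : ℕ} {ε r p M : ℝ} (hε : 0 < ε) (hε1 : ε < 1) (hr : 0 ≤ r)
    (hp : 1 ≤ p) (hM : 0 ≤ M) (g : Fin n → Fin k → ℝ)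
    (h : ∀ u : Fin k → ℝ, eucNorm u = 1 → |lorSum r p (mulVec g u) - M ^ p| ≤ ε * M ^ p)
    (x : Fin k → ℝ) :
    (1 - ε) * M * eucNorm x ≤ lorNorm r p (mulVec g x) ∧
      lorNorm r p (mulVec g x) ≤ (1 + ε) * M * eucNorm x := by
  have hp0 : 0 < p := by linarith
  have hMp : 0 ≤ M ^ p := Real.rpow_nonneg hM p
  have hunit : ∀ u : Fin k → ℝ, eucNorm u = 1 →
      (1 - ε) * M ≤ lorNorm r p (mulVec g u) ∧ lorNorm r p (mulVec g u) ≤ (1 + ε) * M := by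
    intro u hu
    have h1 := abs_le.1 (h u hu)
    rw [← lorNorm_rpow _ hp0] at h1
    have h0 := lorNorm_nonneg r p (mulVec g u)
    constructor
    · rw [← Real.rpow_le_rpow_iff (mul_nonneg (by linarith) hM) h0 hp0,
        Real.mul_rpow (by linarith) hM]
      have h2 : (1 - ε) ^ p ≤ 1 - ε := by
        simpa using Real.rpow_le_rpow_of_exponent_ge (by linarith) (by linarith : 1 - ε ≤ 1) hp
      nlinarith [h1.1]
    · rw [← Real.rpow_le_rpow_iff h0 (mul_nonneg (by linarith) hM) hp0,
        Real.mul_rpow (by linarith) hM]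
      have h2 : 1 + ε ≤ (1 + ε) ^ p := by
        simpa using Real.rpow_le_rpow_of_exponent_le (by linarith : 1 ≤ 1 + ε) hp
      nlinarith [h1.2]
  have hhom : ∀ (t : ℝ) (u : Fin k → ℝ), lorNorm r p (mulVec g (t • u)) =
      |t| * lorNorm r p (mulVec g u) := by
    intro t u
    rw [mulVec_smul]
    exact lorNorm_smul t (mulVec g u) hr hp0
  rcases (eucNorm_nonneg x).eq_or_lt with h0 | h0
  · have hx : x = 0 := by
      rw [eucNorm_eq_norm, eq_comm, norm_eq_zero] at h0
      exact (WithLp.toLp_eq_zero 2).1 h0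
    have := hhom 0 x
    rw [zero_smul, abs_zero, zero_mul, ← hx] at this
    rw [this, ← h0]
    simp
  · set u := (eucNorm x)⁻¹ • x with hu
    have hu1 : eucNorm u = 1 := by
      rw [hu, eucNorm_smul, abs_of_pos (inv_pos.2 h0), inv_mul_cancel₀ h0.ne']
    have hxu : x = eucNorm x • u := by
      rw [hu, smul_smul, mul_inv_cancel₀ h0.ne', one_smul]
    have h2 := hunit u hu1
    have h3 := hhom (eucNorm x) u
    rw [← hxu, abs_of_pos h0] at h3
    rw [h3, mul_comm (eucNorm x)]
    exact ⟨mul_le_mul_of_nonneg_right h2.1 h0.le, mul_le_mul_of_nonneg_right h2.2 h0.le⟩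

lemma gaussMatrix_bad_le {n k : ℕ} (hn : 1 ≤ n) {ε r p M m : ℝ} (hr : 0 ≤ r) (hp : 3 / 2 ≤ p)
    (hm : 1 ≤ m) (hk : (k : ℝ) ≤ m) (hM0 : 0 ≤ M)
    (hM : IsMedian (_root_.stdGaussian n) (lorNorm r p) M)
    (hnum : 25 * (p * (gradSum n r p ^ (1 / (2 * (p - 1))) + 25 *
      lipPow n r p ^ (1 / (2 * (p - 1))) * Real.sqrt m) ^ (p - 1)) * Real.sqrt m ≤ ε * M ^ p) :
    gaussMatrix n k {g | ¬ ∀ u : Fin k → ℝ, eucNorm u = 1 →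
      |lorSum r p (mulVec g u) - M ^ p| ≤ ε * M ^ p} ≤ 18 * ENNReal.ofReal (Real.exp (-m)) := by
  have hq : 0 < 2 * (p - 1) := by linarith
  have hp0 : 0 < p := by linarith
  set H : (Fin n → ℝ) → ℝ := lorNorm (2 * r) (2 * (p - 1)) with hH
  set b := lipPow n r p ^ (1 / (2 * (p - 1))) with hb
  set R₀ := gradSum n r p ^ (1 / (2 * (p - 1))) with hR₀
  set R := R₀ + 25 * b * Real.sqrt m with hR
  set Λ := p * R ^ (p - 1) with hΛ
  have hb0 : 0 < b := Real.rpow_pos_of_pos (lipPow_pos hn r p) _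
  have hR₀0 : 0 ≤ R₀ := Real.rpow_nonneg (gradSum_nonneg n r p) _
  have hm0 : 0 < Real.sqrt m := Real.sqrt_pos.2 (by linarith)
  have hR0 : 0 < R := by positivity
  have hΛ0 : 0 < Λ := by positivity
  have hHlip : EucLip b H := lorNorm_lip hr hp
  have hHR₀ : 3 / 4 ≤ _root_.stdGaussian n {x | H x ≤ R₀} := by
    refine (stdGaussian_lorSum_le hn (r := r) (by linarith : 1 ≤ p)).trans
      (measure_mono fun x hx => ?_)
    exact Real.rpow_le_rpow (lorSum_nonneg _ _ x) hx (by positivity)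
  have hHR : 3 / 4 ≤ _root_.stdGaussian n {x | H x ≤ R} := by
    refine hHR₀.trans (measure_mono fun x (hx : H x ≤ R₀) => ?_)
    exact hx.trans (le_add_of_nonneg_right (by positivity))
  have hHm : MeasurableSet {x | H x ≤ R} :=
    measurableSet_le (hHlip.continuous hb0.le).measurable measurable_const
  obtain ⟨F, hF, hFK⟩ := exists_eucLip_eq_lorSum n hr (by linarith : 1 < p) hR0.le
  have h1 := gaussMatrix_exists_gt_le hb0 hHlip
    (le_trans (by
      rw [ENNReal.div_le_iff (by simp) (by simp), ENNReal.div_mul_cancel (by simp) (by simp)]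
      norm_num) hHR₀) hm hk
  have h2 := gaussMatrix_exists_gt_le hΛ0 hF (a := M ^ p)
    (one_fourth_le_of_half_le hM.2 hHR hHm fun x hx => by
      change F x ≤ M ^ p
      rw [hFK x hx.2, ← lorNorm_rpow x hp0]
      exact Real.rpow_le_rpow (lorNorm_nonneg r p x) hx.1 hp0.le) hm hk
  have h3 := gaussMatrix_exists_gt_le hΛ0 hF.neg (a := -M ^ p)
    (one_fourth_le_of_half_le hM.1 hHR hHm fun x hx => by
      change -F x ≤ -M ^ p
      rw [hFK x hx.2, ← lorNorm_rpow x hp0]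
      exact neg_le_neg (Real.rpow_le_rpow hM0 hx.1 hp0.le)) hm hk
  refine (measure_mono (t := _ ∪ (_ ∪ _)) ?_).trans ((measure_union_le _ _).trans
    ((add_le_add h1 ((measure_union_le _ _).trans (add_le_add h2 h3))).trans_eq ?_))
  · intro g hg
    by_contra hcon
    simp only [Set.mem_union, Set.mem_ofPred_eq, not_or, not_exists, not_and, not_lt] at hcon
    refine hg fun u hu => ?_
    have hHu : H (mulVec g u) ≤ R := hcon.1 u hu
    have hup := hcon.2.1 u hu
    have hlow := hcon.2.2 u hu
    rw [hFK _ hHu] at hup hlow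
    rw [abs_le]
    constructor <;> linarith
  · ring

lemma toReal_good_ge {n k : ℕ} {m : ℝ} {A : Set (Fin n → Fin k → ℝ)}
    (h : gaussMatrix n k Aᶜ ≤ 18 * ENNReal.ofReal (Real.exp (-m))) :
    1 - 18 * Real.exp (-m) ≤ (gaussMatrix n k A).toReal := by
  have h1 : (gaussMatrix n k Aᶜ).toReal ≤ 18 * Real.exp (-m) := by
    have := ENNReal.toReal_mono (by finiteness) h
    rwa [ENNReal.toReal_mul, ENNReal.toReal_ofReal (Real.exp_pos _).le,
      ENNReal.toReal_ofNat] at this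
  have h2 : 1 ≤ gaussMatrix n k A + gaussMatrix n k Aᶜ := by
    rw [← measure_univ (μ := gaussMatrix n k), ← Set.union_compl_self A]
    exact measure_union_le _ _
  have h3 := ENNReal.toReal_mono (by finiteness) h2
  rw [ENNReal.toReal_one, ENNReal.toReal_add (by finiteness) (by finiteness)] at h3
  linarith

lemma mul_rpow_sub_one_le {b x : ℝ} (hb : 0 ≤ b) (hb1 : b ≤ 1) (hx : 0 ≤ x) :
    b * (x + 1) ^ (b - 1) ≤ (x + 1) ^ b - x ^ b := by
  have hx1 : 0 < x + 1 := by linarith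
  have h := rpow_one_add_le_one_add_mul_self (s := -1 / (x + 1))
    (by rw [le_div_iff₀ hx1]; linarith) hb hb1
  have h2 : 1 + -1 / (x + 1) = x / (x + 1) := by field_simp; ring
  rw [h2, Real.div_rpow hx hx1.le, div_le_iff₀ (by positivity)] at h
  rw [Real.rpow_sub_one hx1.ne']
  have h3 : (1 + b * (-1 / (x + 1))) * (x + 1) ^ b =
      (x + 1) ^ b - b * ((x + 1) ^ b / (x + 1)) := by ring
  linarith

lemma neg_mul_rpow_sub_one_le {b x : ℝ} (hb : b ≤ 0) (hx : 0 < x) :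
    -b * (x + 1) ^ (b - 1) ≤ x ^ b - (x + 1) ^ b := by
  have hx1 : 0 < x + 1 := by linarith
  have h : 1 + -b / (x + 1) ≤ (x / (x + 1)) ^ b := by
    rw [Real.rpow_def_of_pos (by positivity)]
    have h1 := Real.add_one_le_exp (Real.log (x / (x + 1)) * b)
    have h2 := Real.log_le_sub_one_of_pos (show 0 < x / (x + 1) by positivity)
    have h3 : x / (x + 1) - 1 = -1 / (x + 1) := by field_simp; ring
    rw [h3] at h2
    have h4 := mul_le_mul_of_nonpos_right h2 hb
    have h5 : -1 / (x + 1) * b = -b / (x + 1) := by ring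
    linarith
  rw [Real.div_rpow hx.le hx1.le, le_div_iff₀ (by positivity)] at h
  rw [Real.rpow_sub_one hx1.ne']
  have h3 : (1 + -b / (x + 1)) * (x + 1) ^ b =
      (x + 1) ^ b + -b * ((x + 1) ^ b / (x + 1)) := by ring
  linarith

lemma mul_sum_rpow_sub_one_le {b : ℝ} (hb : 0 < b) (hb1 : b ≤ 1) (n : ℕ) :
    b * ∑ i : Fin n, ((i : ℝ) + 1) ^ (b - 1) ≤ (n : ℝ) ^ b := by
  rw [Fin.sum_univ_eq_sum_range (fun i : ℕ => ((i : ℝ) + 1) ^ (b - 1)) n]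
  induction n with
  | zero => simp [Real.zero_rpow hb.ne']
  | succ k ih =>
    rw [Finset.sum_range_succ, mul_add]
    push_cast
    have := mul_rpow_sub_one_le hb.le hb1 k.cast_nonneg
    linarith

lemma neg_mul_sum_rpow_sub_one_le {b : ℝ} (hb : b ≤ 0) (n : ℕ) :
    -b * ∑ i : Fin n, ((i : ℝ) + 1) ^ (b - 1) ≤ -b + 1 := by
  rw [Fin.sum_univ_eq_sum_range (fun i : ℕ => ((i : ℝ) + 1) ^ (b - 1)) n]
  rcases n with _ | n
  · simp; linarith
  suffices h : -b * ∑ i ∈ Finset.range (n + 1), ((i : ℝ) + 1) ^ (b - 1) ≤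
      -b + 1 - ((n : ℝ) + 1) ^ b by
    have : 0 < ((n : ℝ) + 1) ^ b := by positivity
    linarith
  induction n with
  | zero => simp
  | succ k ih =>
    rw [Finset.sum_range_succ, mul_add]
    have := neg_mul_rpow_sub_one_le hb (show (0 : ℝ) < (k : ℝ) + 1 by positivity)
    push_cast at this ⊢
    linarith

lemma sum_rpow_sub_one_le {b T : ℝ} {n : ℕ} (hT : 0 ≤ T)
    (hb : ∀ i : Fin n, ((i : ℝ) + 1) ^ b ≤ T) :
    ∑ i : Fin n, ((i : ℝ) + 1) ^ (b - 1) ≤ T * (1 + Real.log n) := by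
  have h1 : ∑ i : Fin n, ((i : ℝ) + 1)⁻¹ ≤ 1 + Real.log n := by
    rw [Fin.sum_univ_eq_sum_range (fun i : ℕ => ((i : ℝ) + 1)⁻¹) n]
    refine le_trans (le_of_eq ?_) (harmonic_le_one_add_log n)
    simp [harmonic]
  refine le_trans ?_ (mul_le_mul_of_nonneg_left h1 hT)
  rw [Finset.mul_sum]
  refine Finset.sum_le_sum fun i _ => ?_
  rw [Real.rpow_sub_one (by positivity), div_eq_mul_inv]
  exact mul_le_mul_of_nonneg_right (hb i) (by positivity)

lemma one_le_log_natCast {n : ℕ} (hn : 3 ≤ n) : 1 ≤ Real.log n := by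
  rw [Real.le_log_iff_exp_le (by positivity)]
  have : (3 : ℝ) ≤ n := by exact_mod_cast hn
  linarith [Real.exp_one_lt_three]

lemma gradSum_le_of_mul_log_le {n : ℕ} (hn : 3 ≤ n) {r p : ℝ} (hr : r ≤ 1 / 2) (hp : 1 ≤ p) :
    gradSum n r p ≤ (n : ℝ) ^ (1 - 2 * r) * (12 * Real.log n) ^ p := by
  have hL := one_le_log_natCast hn
  have hn3 : (3 : ℝ) ≤ n := by exact_mod_cast hn
  have hn0 : (0 : ℝ) < n := by linarith
  have hlog : ∀ i : Fin n, Real.log (6 * n / ((i : ℝ) + 1)) ≤ 3 * Real.log n := by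
    intro i
    have h3 : 3 * Real.log n = Real.log ((n : ℝ) ^ 3) := by rw [Real.log_pow]; norm_num
    rw [h3]
    refine Real.log_le_log (by positivity) ((div_le_self (by positivity) ?_).trans ?_)
    · linarith [(i : ℕ).cast_nonneg (α := ℝ)]
    · have : 3 * 3 ≤ (n : ℝ) * n := by gcongr
      nlinarith
  have hi : ∀ i : Fin n, ((i : ℝ) + 1) ^ (1 - 2 * r) ≤ (n : ℝ) ^ (1 - 2 * r) := fun i =>
    Real.rpow_le_rpow (by positivity) (by exact_mod_cast i.2) (by linarith)
  have hS := sum_rpow_sub_one_le (by positivity) hi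
  have h1 : gradSum n r p ≤
      (∑ i : Fin n, ((i : ℝ) + 1) ^ (1 - 2 * r - 1)) * (12 * Real.log n) ^ (p - 1) := by
    rw [gradSum, Finset.sum_mul]
    refine Finset.sum_le_sum fun i _ => ?_
    rw [show 1 - 2 * r - 1 = -(2 * r) by ring]
    refine mul_le_mul_of_nonneg_left (Real.rpow_le_rpow ?_ ?_ (by linarith)) (by positivity)
    · exact mul_nonneg (by norm_num) (log_six_mul_div_nonneg i)
    · linarith [hlog i]
  have h12 : 0 < 12 * Real.log n := by linarith
  calc _ ≤ _ := h1
    _ ≤ (n : ℝ) ^ (1 - 2 * r) * (12 * Real.log n) * (12 * Real.log n) ^ (p - 1) := by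
        refine mul_le_mul_of_nonneg_right (hS.trans ?_) (by positivity)
        exact mul_le_mul_of_nonneg_left (by linarith) (by positivity)
    _ = _ := by
        rw [mul_assoc, Real.rpow_sub_one h12.ne', mul_div_cancel₀ _ h12.ne']

lemma gradSum_le_of_pos {n : ℕ} (hn : 3 ≤ n) {r p : ℝ} (hr0 : 0 ≤ r) (hr : 0 < 1 - 2 * r)
    (hp : 1 ≤ p) :
    gradSum n r p ≤ (n : ℝ) ^ (1 - 2 * r) * (8 * p / (1 - 2 * r)) ^ p := by
  set a := 1 - 2 * r with ha
  have ha1 : a ≤ 1 := by linarith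
  have hn0 : (0 : ℝ) < n := by positivity
  have hp0 : 0 < p := by linarith
  have hD : 0 < 8 * p / a := by positivity
  have hterm : ∀ i : Fin n, ((i : ℝ) + 1) ^ (-(2 * r)) *
      (4 * Real.log (6 * n / ((i : ℝ) + 1))) ^ (p - 1) ≤
      (8 * p / a) ^ (p - 1) * (6 * n) ^ (a / 2) * ((i : ℝ) + 1) ^ (a / 2 - 1) := by
    intro i
    have hi0 : (0 : ℝ) < (i : ℝ) + 1 := by positivity
    have hin : (i : ℝ) + 1 ≤ n := by exact_mod_cast i.2
    set y := 6 * n / ((i : ℝ) + 1) with hy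
    have hy1 : 1 ≤ y := by rw [hy, le_div_iff₀ hi0]; linarith
    have h1 : 4 * Real.log y ≤ 8 * p / a * y ^ (a / (2 * p)) := by
      have := Real.log_le_rpow_div (by linarith : 0 ≤ y) (show 0 < a / (2 * p) by positivity)
      calc 4 * Real.log y ≤ 4 * (y ^ (a / (2 * p)) / (a / (2 * p))) := by linarith
        _ = _ := by field_simp; ring
    have h2 : (4 * Real.log y) ^ (p - 1) ≤ (8 * p / a) ^ (p - 1) * y ^ (a / 2) := by
      refine (Real.rpow_le_rpow (mul_nonneg (by norm_num) (Real.log_nonneg hy1)) h1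
        (by linarith)).trans ?_
      rw [Real.mul_rpow hD.le (by positivity), ← Real.rpow_mul (by linarith)]
      refine mul_le_mul_of_nonneg_left (Real.rpow_le_rpow_of_exponent_le hy1 ?_) (by positivity)
      rw [div_mul_eq_mul_div, div_le_div_iff₀ (by positivity) (by norm_num)]
      nlinarith
    refine (mul_le_mul_of_nonneg_left h2 (by positivity)).trans_eq ?_
    rw [hy, Real.div_rpow (by positivity) hi0.le, show -(2 * r) = a / 2 - 1 + a / 2 by linarith,
      Real.rpow_add hi0]
    field_simp
  have h6 : (6 : ℝ) ^ (a / 2) ≤ 4 := by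
    calc (6 : ℝ) ^ (a / 2) ≤ 6 ^ (1 / 2 : ℝ) :=
          Real.rpow_le_rpow_of_exponent_le (by norm_num) (by linarith)
      _ ≤ 16 ^ (1 / 2 : ℝ) := Real.rpow_le_rpow (by norm_num) (by norm_num) (by norm_num)
      _ = 4 := by rw [← Real.sqrt_eq_rpow, show (16 : ℝ) = 4 ^ 2 by norm_num]; simp
  have hsum := mul_sum_rpow_sub_one_le (show 0 < a / 2 by positivity) (by linarith) n
  rw [← le_div_iff₀' (by positivity)] at hsum
  calc gradSum n r p ≤ ∑ i : Fin n,
        (8 * p / a) ^ (p - 1) * (6 * n) ^ (a / 2) * ((i : ℝ) + 1) ^ (a / 2 - 1) :=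
        Finset.sum_le_sum fun i _ => hterm i
    _ = (8 * p / a) ^ (p - 1) * (6 * n) ^ (a / 2) *
        ∑ i : Fin n, ((i : ℝ) + 1) ^ (a / 2 - 1) := by rw [Finset.mul_sum]
    _ ≤ (8 * p / a) ^ (p - 1) * (4 * n ^ (a / 2)) * (n ^ (a / 2) / (a / 2)) := by
        rw [Real.mul_rpow (by norm_num) hn0.le]
        gcongr
    _ = (n ^ (a / 2) * n ^ (a / 2)) * ((8 * p / a) ^ (p - 1) * (8 / a)) := by
        field_simp; ring
    _ ≤ n ^ a * ((8 * p / a) ^ (p - 1) * (8 * p / a)) := by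
        rw [← Real.rpow_add hn0, add_halves]
        gcongr
        linarith
    _ = _ := by rw [Real.rpow_sub_one hD.ne', div_mul_cancel₀ _ hD.ne']

lemma gradSum_mul_le {n : ℕ} (hn : 3 ≤ n) {r p : ℝ} (hr0 : 0 ≤ r) (hr : r ≤ 1 / 2)
    (hp : 1 ≤ p) :
    gradSum n r p * ((p + (1 - 2 * r) * Real.log n) / Real.log n) ^ p ≤
      (n : ℝ) ^ (1 - 2 * r) * (24 * p) ^ p := by
  have hL := one_le_log_natCast hn
  have hL0 : 0 < Real.log n := by linarith
  have ha : 0 ≤ 1 - 2 * r := by linarith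
  have hp0 : 0 < p := by linarith
  have hS := gradSum_nonneg n r p
  set L := Real.log n
  set a := 1 - 2 * r
  rcases le_or_gt (a * L) p with h | h
  · have h1 : (p + a * L) / L ≤ 2 * p / L := by gcongr; linarith
    calc _ ≤ (n : ℝ) ^ a * (12 * L) ^ p * (2 * p / L) ^ p := by
          gcongr
          exact gradSum_le_of_mul_log_le hn hr hp
      _ = _ := by
          rw [mul_assoc, ← Real.mul_rpow (by positivity) (by positivity)]
          congr 2
          field_simp; ring
  · have ha0 : 0 < a := by
      by_contra hcon
      nlinarith
    have h1 : (p + a * L) / L ≤ 2 * a := by rw [div_le_iff₀ hL0]; linarith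
    calc _ ≤ (n : ℝ) ^ a * (8 * p / a) ^ p * (2 * a) ^ p := by
          gcongr
          exact gradSum_le_of_pos hn hr0 ha0 hp
      _ = (n : ℝ) ^ a * (16 * p) ^ p := by
          rw [mul_assoc, ← Real.mul_rpow (by positivity) (by positivity)]
          congr 2
          field_simp; ring
      _ ≤ _ := by gcongr; norm_num

lemma lipPow_mul_le {n : ℕ} (hn : 3 ≤ n) {r p : ℝ} (hr0 : 0 ≤ r) (hr : r ≤ 1 / 2)
    (hp : 3 / 2 ≤ p) :
    lipPow n r p * ((1 + |2 - 2 * r - p| * Real.log n) / Real.log n) ^ max (2 - p) 0 ≤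
      4 * (1 + (n : ℝ) ^ ((2 - 2 * r - p) / p)) ^ p := by
  have hL := one_le_log_natCast hn
  have hL0 : 0 < Real.log n := by linarith
  have hn1 : (1 : ℝ) ≤ n := by exact_mod_cast (by omega : 1 ≤ n)
  have hp0 : 0 < p := by linarith
  set d := 2 - 2 * r - p with hd
  have hden : 1 ≤ (1 + (n : ℝ) ^ (d / p)) ^ p :=
    Real.one_le_rpow (by linarith [Real.rpow_nonneg (by linarith : (0 : ℝ) ≤ n) (d / p)]) hp0.le
  rcases le_or_gt 2 p with h | h
  · rw [lipPow, if_pos h, max_eq_right (by linarith), Real.rpow_zero]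
    linarith
  · rw [lipPow, if_neg (by linarith), max_eq_left (by linarith)]
    have h2 : 0 < 2 - p := by linarith
    set β := d / (2 - p) with hβ
    have hdβ : d = β * (2 - p) := by rw [hβ, div_mul_cancel₀ _ h2.ne']
    have he : ∀ i : Fin n, ((i : ℝ) + 1) ^ (-(2 * r / (2 - p))) = ((i : ℝ) + 1) ^ (β - 1) := by
      intro i
      congr 1
      rw [hβ, hd]
      field_simp; ring
    rw [Finset.sum_congr rfl fun i _ => he i]
    set S := ∑ i : Fin n, ((i : ℝ) + 1) ^ (β - 1) with hS
    have hS0 : 0 ≤ S := Finset.sum_nonneg fun i _ => by positivity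
    set T := max 1 ((n : ℝ) ^ β) with hT
    have hT1 : 1 ≤ T := le_max_left _ _
    have hβT : ∀ i : Fin n, ((i : ℝ) + 1) ^ β ≤ T := by
      intro i
      rcases le_total 0 β with h0 | h0
      · exact (Real.rpow_le_rpow (by positivity) (by exact_mod_cast i.2) h0).trans
          (le_max_right _ _)
      · refine (Real.rpow_le_one_of_one_le_of_nonpos ?_ h0).trans hT1
        linarith [(i : ℕ).cast_nonneg (α := ℝ)]
    have hS1 : S ≤ T * (1 + Real.log n) := sum_rpow_sub_one_le (by linarith) hβT
    have hS2 : |d| * S ≤ 2 * T := by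
      have habs : |d| = |β| * (2 - p) := by rw [hdβ, abs_mul, abs_of_pos h2]
      rcases lt_or_ge 0 β with h0 | h0
      · have hβ1 : β ≤ 1 := by rw [hβ, div_le_one h2]; linarith
        have h3 := mul_sum_rpow_sub_one_le h0 hβ1 n
        have h4 : (n : ℝ) ^ β ≤ T := le_max_right _ _
        rw [habs, abs_of_pos h0]
        have h5 : 0 ≤ β * S := mul_nonneg h0.le hS0
        nlinarith
      · have h3 := neg_mul_sum_rpow_sub_one_le h0 n
        rw [habs, abs_of_nonpos h0]
        have h4 : -β * (2 - p) ≤ 1 := by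
          have : -β * (2 - p) = -d := by rw [hdβ]; ring
          rw [this, hd]; linarith
        calc -β * (2 - p) * S = (-β * S) * (2 - p) := by ring
          _ ≤ (-β + 1) * (2 - p) := mul_le_mul_of_nonneg_right h3 h2.le
          _ ≤ 2 * T := by nlinarith
    have hSQ : S * ((1 + |d| * Real.log n) / Real.log n) ≤ 4 * T := by
      rw [mul_div_assoc', div_le_iff₀ hL0]
      nlinarith [mul_le_mul_of_nonneg_right hS2 hL0.le,
        mul_le_mul_of_nonneg_left hL (by linarith : 0 ≤ T)]
    have hQ0 : 0 ≤ (1 + |d| * Real.log n) / Real.log n := by positivity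
    have hn0 : (0 : ℝ) < n := by linarith
    rw [← Real.mul_rpow hS0 hQ0]
    calc _ ≤ (4 * T) ^ (2 - p) := Real.rpow_le_rpow (mul_nonneg hS0 hQ0) hSQ h2.le
      _ = 4 ^ (2 - p) * T ^ (2 - p) := Real.mul_rpow (by norm_num) (by linarith)
      _ ≤ 4 * (1 + (n : ℝ) ^ (d / p)) ^ p := by
          have h4 : (4 : ℝ) ^ (2 - p) ≤ 4 := by
            simpa using Real.rpow_le_rpow_of_exponent_le (by norm_num : (1 : ℝ) ≤ 4)
              (by linarith : 2 - p ≤ 1)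
          have h5 : T ^ (2 - p) ≤ (1 + (n : ℝ) ^ (d / p)) ^ p := by
            rcases max_choice 1 ((n : ℝ) ^ β) with h6 | h6
            · rw [hT, h6, Real.one_rpow]; exact hden
            · rw [hT, h6, ← Real.rpow_mul hn0.le, ← hdβ]
              calc (n : ℝ) ^ d = ((n : ℝ) ^ (d / p)) ^ p := by
                    rw [← Real.rpow_mul hn0.le, div_mul_cancel₀ _ hp0.ne']
                _ ≤ _ := Real.rpow_le_rpow (by positivity) (by linarith) hp0.le
          gcongr
lemma Eia_le {n : ℕ} (hn : 3 ≤ n) {ε r p c : ℝ} (hr : r ≤ 1 / 2) (hp : 1 ≤ p) (hc : 0 < c) :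
    Eia n ε r p c ≤
      c ^ p * n * ((p + (1 - 2 * r) * Real.log n) / Real.log n) ^ p * ε ^ 2 := by
  have hL := one_le_log_natCast hn
  have hL0 : 0 < Real.log n := by linarith
  have ha : 0 ≤ 1 - 2 * r := by linarith
  have hp0 : 0 < p := by linarith
  have h1 : 0 ≤ (1 - 2 * r) * Real.log n := by positivity
  rw [Eia, Real.div_rpow (by positivity) hL0.le, div_le_iff₀ (by positivity)]
  have h2 : Real.log n ^ 2 * Real.log n ^ p ≤ (p + Real.log n) ^ (2 + p) := by
    rw [← Real.rpow_two, ← Real.rpow_add hL0]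
    exact Real.rpow_le_rpow hL0.le (by linarith) (by linarith)
  set A := c ^ p * n * (p + (1 - 2 * r) * Real.log n) ^ p * ε ^ 2 with hA
  have hA0 : 0 ≤ A := by positivity
  have hLp : 0 < Real.log n ^ p := by positivity
  calc _ = A * (Real.log n ^ 2 * Real.log n ^ p) / Real.log n ^ p := by
        rw [hA]; field_simp
    _ ≤ A * (p + Real.log n) ^ (2 + p) / Real.log n ^ p := by gcongr
    _ = _ := by rw [hA]; field_simp

lemma Eia_le_rpow_mul {n : ℕ} (hn : 3 ≤ n) {ε r p c : ℝ} (hε : 0 < ε) (hε1 : ε ≤ 1)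
    (hr0 : 0 ≤ r) (hr : r ≤ 1 / 2) (hp : 1 ≤ p) (hc : 0 < c) : Eia n ε r p c ≤ c ^ p * n := by
  have hL := one_le_log_natCast hn
  have hL0 : 0 < Real.log n := by linarith
  have ha : 0 ≤ 1 - 2 * r := by linarith
  have hp0 : 0 < p := by linarith
  have h1 : 0 ≤ (1 - 2 * r) * Real.log n := by positivity
  have h2 : (1 - 2 * r) * Real.log n ≤ Real.log n := by nlinarith
  rw [Eia, div_le_iff₀ (by positivity), Real.rpow_add (by positivity), Real.rpow_two]
  calc _ = c ^ p * n * (Real.log n ^ 2 * (p + (1 - 2 * r) * Real.log n) ^ p * ε ^ 2) := by ring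
    _ ≤ c ^ p * n * ((p + Real.log n) ^ 2 * (p + Real.log n) ^ p * 1 ^ 2) := by
        gcongr
        linarith
    _ = _ := by ring

lemma Fia_nonneg {n : ℕ} {ε r p c : ℝ} (hε : 0 < ε) (hp : 0 < p) (hc : 0 < c) :
    0 ≤ Fia n ε r p c := by
  have hL0 : 0 ≤ Real.log n := Real.log_natCast_nonneg n
  unfold Fia
  positivity

lemma lipPow_mul_Fia_rpow_le {n : ℕ} (hn : 3 ≤ n) {ε r p c : ℝ} (hε : 0 < ε) (hr0 : 0 ≤ r)
    (hr : r ≤ 1 / 2) (hp : 3 / 2 ≤ p) (hc : 0 < c) :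
    lipPow n r p * Fia n ε r p c ^ p ≤
      4 * c ^ p * p ^ p * (n : ℝ) ^ (2 * (1 - r)) * ε ^ 2 := by
  have hL := one_le_log_natCast hn
  have hL0 : 0 < Real.log n := by linarith
  have hp0 : 0 < p := by linarith
  have hn0 : (0 : ℝ) < n := by positivity
  have hB := lipPow_mul_le hn hr0 hr hp
  set Q := (1 + |2 - 2 * r - p| * Real.log n) / Real.log n with hQ
  have hQ0 : 0 ≤ Q := by positivity
  set D := 1 + (n : ℝ) ^ ((2 - 2 * r - p) / p) with hD
  have hD0 : 0 < D := by positivity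
  have hF : Fia n ε r p c ≤
      c * p * (n : ℝ) ^ (2 * (1 - r) / p) * ε ^ (2 / p) / D * Q ^ max ((2 - p) / p) 0 := by
    rw [Fia, ← hQ, ← hD]
    refine mul_le_mul_of_nonneg_right ?_ (by positivity)
    rw [div_le_div_iff₀ (by positivity) hD0]
    have h1 : Real.log n ^ (1 + 2 / p) ≤ (p + Real.log n) ^ (1 + 2 / p) :=
      Real.rpow_le_rpow hL0.le (by linarith) (by positivity)
    calc _ = c * p * (n : ℝ) ^ (2 * (1 - r) / p) * ε ^ (2 / p) * D *
          Real.log n ^ (1 + 2 / p) := by ring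
      _ ≤ c * p * (n : ℝ) ^ (2 * (1 - r) / p) * ε ^ (2 / p) * D *
          (p + Real.log n) ^ (1 + 2 / p) := by gcongr
      _ = _ := by ring
  have hw : max ((2 - p) / p) 0 * p = max (2 - p) 0 := by
    rw [max_mul_of_nonneg _ _ hp0.le, div_mul_cancel₀ _ hp0.ne', zero_mul]
  have hFp : Fia n ε r p c ^ p ≤
      c ^ p * p ^ p * (n : ℝ) ^ (2 * (1 - r)) * ε ^ 2 / D ^ p * Q ^ max (2 - p) 0 := by
    refine (Real.rpow_le_rpow (Fia_nonneg hε hp0 hc) hF hp0.le).trans_eq ?_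
    rw [Real.mul_rpow (by positivity) (by positivity), Real.div_rpow (by positivity) hD0.le,
      Real.mul_rpow (by positivity) (by positivity), Real.mul_rpow (by positivity) (by positivity),
      Real.mul_rpow hc.le hp0.le, ← Real.rpow_mul hn0.le, ← Real.rpow_mul hε.le,
      ← Real.rpow_mul hQ0, hw, div_mul_cancel₀ _ hp0.ne', div_mul_cancel₀ _ hp0.ne',
      Real.rpow_two]
  calc _ ≤ lipPow n r p *
        (c ^ p * p ^ p * (n : ℝ) ^ (2 * (1 - r)) * ε ^ 2 / D ^ p * Q ^ max (2 - p) 0) :=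
        mul_le_mul_of_nonneg_left hFp (lipPow_nonneg _ _ _)
    _ = c ^ p * p ^ p * (n : ℝ) ^ (2 * (1 - r)) * ε ^ 2 / D ^ p *
        (lipPow n r p * Q ^ max (2 - p) 0) := by ring
    _ ≤ c ^ p * p ^ p * (n : ℝ) ^ (2 * (1 - r)) * ε ^ 2 / D ^ p * (4 * D ^ p) := by gcongr
    _ = _ := by field_simp

lemma add_rpow_le_two_rpow_mul {x y s : ℝ} (hx : 0 ≤ x) (hy : 0 ≤ y) (hs : 0 ≤ s) :
    (x + y) ^ s ≤ 2 ^ s * (x ^ s + y ^ s) := by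
  have hx' := Real.rpow_nonneg hx s
  have hy' := Real.rpow_nonneg hy s
  rcases le_total x y with h | h
  · calc (x + y) ^ s ≤ (2 * y) ^ s := Real.rpow_le_rpow (by positivity) (by linarith) hs
      _ = 2 ^ s * y ^ s := Real.mul_rpow (by norm_num) hy
      _ ≤ _ := by gcongr; linarith
  · calc (x + y) ^ s ≤ (2 * x) ^ s := Real.rpow_le_rpow (by positivity) (by linarith) hs
      _ = 2 ^ s * x ^ s := Real.mul_rpow (by norm_num) hx
      _ ≤ _ := by gcongr; linarith

lemma radius_bound_le {p S B m V : ℝ} (hp : 1 < p) (hS : 0 ≤ S) (hB : 0 ≤ B) (hm : 0 < m)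
    (hV : 0 ≤ V) (h1 : 2500 * p ^ 2 * 4 ^ p * (S * m) ≤ V ^ 2)
    (h2 : 2500 * p ^ 2 * 2500 ^ p * (B * m ^ p) ≤ V ^ 2) :
    25 * (p * (S ^ (1 / (2 * (p - 1))) + 25 * B ^ (1 / (2 * (p - 1))) * Real.sqrt m) ^ (p - 1)) *
      Real.sqrt m ≤ V := by
  have hs : 0 < p - 1 := by linarith
  have hm0 : 0 < Real.sqrt m := Real.sqrt_pos.2 hm
  have hhalf : ∀ {y : ℝ}, 0 ≤ y → (y ^ (1 / (2 * (p - 1)))) ^ (p - 1) = Real.sqrt y := by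
    intro y hy
    rw [← Real.rpow_mul hy, Real.sqrt_eq_rpow]
    congr 1
    field_simp
  have hsq : ∀ a : ℝ, 0 < a → (a ^ (p - 1)) ^ 2 ≤ (a ^ 2) ^ p / a ^ 2 := by
    intro a ha
    rw [← Real.rpow_natCast, ← Real.rpow_natCast, ← Real.rpow_mul ha.le, ← Real.rpow_mul ha.le,
      ← Real.rpow_sub ha]
    apply le_of_eq
    congr 1
    push_cast; ring
  have hexp := add_rpow_le_two_rpow_mul (Real.rpow_nonneg hS (1 / (2 * (p - 1))))
    (show 0 ≤ 25 * B ^ (1 / (2 * (p - 1))) * Real.sqrt m by positivity) hs.le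
  rw [Real.mul_rpow (by positivity) hm0.le, Real.mul_rpow (by norm_num) (by positivity),
    hhalf hS, hhalf hB] at hexp
  have hX : 25 * p * 2 ^ (p - 1) * Real.sqrt S * Real.sqrt m ≤ V / 2 := by
    refine abs_le_of_sq_le_sq' ?_ (by positivity) |>.2
    have h3 := hsq 2 (by norm_num)
    norm_num at h3
    calc (25 * p * 2 ^ (p - 1) * Real.sqrt S * Real.sqrt m) ^ 2 =
        625 * p ^ 2 * (2 ^ (p - 1)) ^ 2 * (S * m) := by
          rw [mul_pow, mul_pow, mul_pow, mul_pow, Real.sq_sqrt hS, Real.sq_sqrt hm.le]; ring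
      _ ≤ 625 * p ^ 2 * 4 ^ p * (S * m) := by
          gcongr
          have : (0 : ℝ) < 4 ^ p := by positivity
          linarith
      _ ≤ (V / 2) ^ 2 := by linarith
  have hY : 25 * p * 2 ^ (p - 1) * (25 ^ (p - 1) * Real.sqrt B * Real.sqrt m ^ (p - 1)) *
      Real.sqrt m ≤ V / 2 := by
    refine abs_le_of_sq_le_sq' ?_ (by positivity) |>.2
    have h3 := hsq 50 (by norm_num)
    norm_num at h3
    have h4 : Real.sqrt m ^ (p - 1) * Real.sqrt m = Real.sqrt m ^ p := by
      rw [Real.rpow_sub_one hm0.ne', div_mul_cancel₀ _ hm0.ne']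
    have h5 : (Real.sqrt m ^ p) ^ 2 = m ^ p := by
      rw [← Real.rpow_natCast, ← Real.rpow_mul hm0.le, mul_comm p, Real.rpow_mul hm0.le,
        Real.rpow_natCast, Real.sq_sqrt hm.le]
    have h6 : (2 : ℝ) ^ (p - 1) * 25 ^ (p - 1) = 50 ^ (p - 1) := by
      rw [← Real.mul_rpow (by norm_num) (by norm_num)]; norm_num
    calc _ = (25 * p * (2 ^ (p - 1) * 25 ^ (p - 1)) * Real.sqrt B *
          (Real.sqrt m ^ (p - 1) * Real.sqrt m)) ^ 2 := by ring
      _ = 625 * p ^ 2 * (50 ^ (p - 1)) ^ 2 * (B * m ^ p) := by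
          rw [h4, h6, mul_pow, mul_pow, mul_pow, mul_pow, Real.sq_sqrt hB, h5]; ring
      _ ≤ 625 * p ^ 2 * 2500 ^ p * (B * m ^ p) := by
          gcongr
          have : (0 : ℝ) < 2500 ^ p := by positivity
          linarith
      _ ≤ (V / 2) ^ 2 := by linarith
  calc _ ≤ 25 * (p * (2 ^ (p - 1) * (Real.sqrt S +
        25 ^ (p - 1) * Real.sqrt B * Real.sqrt m ^ (p - 1)))) * Real.sqrt m := by gcongr
    _ ≤ V := by linarith

lemma const_mul_sq_mul_rpow_le {A D b p : ℝ} (hp : 3 / 2 ≤ p) (hD : 0 ≤ D)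
    (hA : A ≤ Real.exp 10) (hDb : D ≤ Real.exp b) (hb : b ≤ 10) :
    A * p ^ 2 * D ^ p * Real.exp (-28) ^ p ≤ Real.exp (-(4 * p)) ^ 2 := by
  have h1 : p ^ 2 ≤ Real.exp (2 * p) := by
    rw [two_mul, Real.exp_add, ← sq]
    have := Real.add_one_le_exp p
    gcongr
    linarith
  have h2 : D ^ p ≤ Real.exp (b * p) := by
    rw [Real.exp_mul]
    exact Real.rpow_le_rpow hD hDb (by linarith)
  calc A * p ^ 2 * D ^ p * Real.exp (-28) ^ p
      ≤ Real.exp 10 * Real.exp (2 * p) * Real.exp (b * p) * Real.exp (-28 * p) := by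
        rw [← Real.exp_mul]; gcongr
    _ ≤ Real.exp (-(4 * p)) ^ 2 := by
        rw [← Real.exp_add, ← Real.exp_add, ← Real.exp_add, ← Real.exp_nat_mul,
          Real.exp_le_exp]
        push_cast
        nlinarith

lemma radius_bound_min_le {n : ℕ} (hn : 3 ≤ n) {ε r p M : ℝ} (hε : 0 < ε) (hr0 : 0 ≤ r)
    (hr : r ≤ 1 / 2) (hp : 3 / 2 ≤ p)
    (hm : 0 < min (Eia n ε r p (Real.exp (-28))) (Fia n ε r p (Real.exp (-28))))
    (hM : (n : ℝ) ^ (1 - r) * Real.exp (-(4 * p)) * p ^ (p / 2) ≤ M ^ p) :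
    25 * (p * (gradSum n r p ^ (1 / (2 * (p - 1))) + 25 * lipPow n r p ^ (1 / (2 * (p - 1))) *
      Real.sqrt (min (Eia n ε r p (Real.exp (-28))) (Fia n ε r p (Real.exp (-28))))) ^ (p - 1)) *
      Real.sqrt (min (Eia n ε r p (Real.exp (-28))) (Fia n ε r p (Real.exp (-28)))) ≤
      ε * M ^ p := by
  have hp0 : 0 < p := by linarith
  have hn0 : (0 : ℝ) < n := by positivity
  have hmE := min_le_left (Eia n ε r p (Real.exp (-28))) (Fia n ε r p (Real.exp (-28)))
  have hmF := min_le_right (Eia n ε r p (Real.exp (-28))) (Fia n ε r p (Real.exp (-28)))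
  set m := min (Eia n ε r p (Real.exp (-28))) (Fia n ε r p (Real.exp (-28)))
  have hc := Real.exp_pos (-28)
  have hEle := hmE.trans (Eia_le hn (ε := ε) hr (by linarith : 1 ≤ p) hc)
  have hFle := Real.rpow_le_rpow hm.le hmF hp0.le
  have hFB := lipPow_mul_Fia_rpow_le hn hε hr0 hr hp hc
  have hS := gradSum_mul_le hn hr0 hr (by linarith : 1 ≤ p)
  have hS0 := gradSum_nonneg n r p
  have hB0 := lipPow_nonneg n r p
  set c := Real.exp (-28)
  have hpp : (p ^ (p / 2)) ^ 2 = p ^ p := by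
    rw [← Real.rpow_natCast, ← Real.rpow_mul hp0.le]; congr 1; push_cast; ring
  have hnn : ((n : ℝ) ^ (1 - r)) ^ 2 = (n : ℝ) ^ (2 * (1 - r)) := by
    rw [← Real.rpow_natCast, ← Real.rpow_mul hn0.le]; congr 1; push_cast; ring
  have hexp : ∀ {k : ℕ} {y : ℝ}, y ≤ 2.7 ^ k → y ≤ Real.exp k := by
    intro k y hy
    refine hy.trans ?_
    rw [← Real.exp_one_pow]
    exact pow_le_pow_left₀ (by norm_num) (by linarith [Real.exp_one_gt_d9]) k
  have hV : (ε * ((n : ℝ) ^ (1 - r) * Real.exp (-(4 * p)) * p ^ (p / 2))) ^ 2 =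
      Real.exp (-(4 * p)) ^ 2 * (p ^ p * (n : ℝ) ^ (2 * (1 - r)) * ε ^ 2) := by
    rw [mul_pow, mul_pow, mul_pow, hpp, hnn]; ring
  have hW : 0 ≤ p ^ p * (n : ℝ) ^ (2 * (1 - r)) * ε ^ 2 := by positivity
  refine (radius_bound_le (by linarith) hS0 hB0 hm
    (V := ε * ((n : ℝ) ^ (1 - r) * Real.exp (-(4 * p)) * p ^ (p / 2)))
    (by positivity) ?_ ?_).trans (mul_le_mul_of_nonneg_left hM hε.le)
  · rw [hV]
    have h1 := const_mul_sq_mul_rpow_le (A := 2500) (D := 96) (b := 5) hp (by norm_num)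
      (by exact_mod_cast hexp (k := 10) (by norm_num))
      (by exact_mod_cast hexp (k := 5) (by norm_num)) (by norm_num)
    refine le_trans ?_ (mul_le_mul_of_nonneg_right h1 hW)
    have h96 : (96 : ℝ) ^ p = 4 ^ p * 24 ^ p := by
      rw [← Real.mul_rpow (by norm_num) (by norm_num)]; norm_num
    calc _ ≤ 2500 * p ^ 2 * 4 ^ p * (gradSum n r p *
          (c ^ p * n * ((p + (1 - 2 * r) * Real.log n) / Real.log n) ^ p * ε ^ 2)) := by gcongr
      _ = 2500 * p ^ 2 * 4 ^ p * c ^ p * n * ε ^ 2 * (gradSum n r p *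
          ((p + (1 - 2 * r) * Real.log n) / Real.log n) ^ p) := by ring
      _ ≤ 2500 * p ^ 2 * 4 ^ p * c ^ p * n * ε ^ 2 *
          ((n : ℝ) ^ (1 - 2 * r) * (24 * p) ^ p) := by gcongr
      _ = _ := by
          rw [Real.mul_rpow (by norm_num) hp0.le, h96,
            show 2 * (1 - r) = 1 + (1 - 2 * r) by ring, Real.rpow_add hn0, Real.rpow_one]
          ring
  · rw [hV]
    have h1 := const_mul_sq_mul_rpow_le (A := 10000) (D := 2500) (b := 8) hp (by norm_num)
      (by exact_mod_cast hexp (k := 10) (by norm_num))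
      (by exact_mod_cast hexp (k := 8) (by norm_num)) (by norm_num)
    refine le_trans ?_ (mul_le_mul_of_nonneg_right h1 hW)
    calc _ ≤ 2500 * p ^ 2 * 2500 ^ p * (lipPow n r p * Fia n ε r p c ^ p) := by gcongr
      _ ≤ 2500 * p ^ 2 * 2500 ^ p *
          (4 * c ^ p * p ^ p * (n : ℝ) ^ (2 * (1 - r)) * ε ^ 2) := by gcongr
      _ = _ := by ring

/-- Main theorem, Case ia: there are universal constants `C, c > 0` such that for
`n ≥ 3`, `ε ∈ (0,1/2)`, `r ∈ [0,1/2]`, `p ∈ [3/2,∞)`, with `E`, `F` as above: if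
`k ≤ min{E,F}` then with probability at least `1 - C exp(-min{E,F})`, for all `x ∈ ℝ^k`,
`(1-ε) M_{r,p} |x| ≤ |Gx|_{r,p} ≤ (1+ε) M_{r,p} |x|`, where `M_{r,p}` is a median of
`|·|_{r,p}` under the standard Gaussian on `ℝ^n` (the law of `Ge₁`). -/
theorem dvoretzky_lorentz_case_ia :
    ∃ C c : ℝ, 0 < C ∧ 0 < c ∧
      ∀ (n k : ℕ) (ε r p : ℝ), 3 ≤ n → 0 < ε → ε < 1 / 2 →
        0 ≤ r → r ≤ 1 / 2 → 3 / 2 ≤ p →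
        (k : ℝ) ≤ min (Eia n ε r p c) (Fia n ε r p c) →
        ∀ M : ℝ, IsMedian (stdGaussian n) (lorNorm r p) M →
          1 - C * Real.exp (-min (Eia n ε r p c) (Fia n ε r p c)) ≤
            ((gaussMatrix n k) {g | ∀ x : Fin k → ℝ,
              (1 - ε) * M * eucNorm x ≤ lorNorm r p (mulVec g x) ∧
              lorNorm r p (mulVec g x) ≤ (1 + ε) * M * eucNorm x}).toReal := by
  refine ⟨Real.exp 4, Real.exp (-28), Real.exp_pos _, Real.exp_pos _, ?_⟩
  intro n k ε r p hn hε hε2 hr0 hr hp hk M hM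
  have hrad := radius_bound_min_le (M := M) hn hε hr0 hr hp
  have hmE := min_le_left (Eia n ε r p (Real.exp (-28))) (Fia n ε r p (Real.exp (-28)))
  set m := min (Eia n ε r p (Real.exp (-28))) (Fia n ε r p (Real.exp (-28)))
  rcases lt_or_ge m 4 with hm | hm
  · refine le_trans ?_ ENNReal.toReal_nonneg
    rw [← Real.exp_add, sub_nonpos]
    exact Real.one_le_exp (by linarith)
  have h4 : 4 ≤ n * Real.exp (-(3 * p)) := by
    refine hm.trans (hmE.trans ((Eia_le_rpow_mul hn hε (by linarith) hr0 hr (by linarith)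
      (Real.exp_pos _)).trans ?_))
    rw [mul_comm, ← Real.exp_mul]
    gcongr
    linarith
  obtain ⟨hM0, hMp⟩ := IsMedian.le_rpow hr0 hp h4 hM
  have h18 : 18 * Real.exp (-m) ≤ Real.exp 4 * Real.exp (-m) := by
    have h1 : (18 : ℝ) ≤ Real.exp 4 := by
      have h2 : Real.exp 4 = Real.exp 1 ^ 4 := by rw [← Real.exp_nat_mul]; norm_num
      rw [h2]
      calc (18 : ℝ) ≤ 2.7 ^ 4 := by norm_num
        _ ≤ _ := pow_le_pow_left₀ (by norm_num) (by linarith [Real.exp_one_gt_d9]) 4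
    gcongr
  refine le_trans (by linarith) (toReal_good_ge ((measure_mono ?_).trans
    (gaussMatrix_bad_le (by omega) hr0 hp (by linarith) hk hM0 hM (hrad (by linarith) hMp))))
  intro g hg hgood
  exact hg (lorNorm_mulVec_bounds hε (by linarith) hr0 (by linarith) hM0 g hgood)
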